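/- Let n ≥ 2. The congruences on the 0-twisted partition monoid P_{n,0}^Φ are precisely the following relations: the Rees congruences R_q := {(a,b) : a = b, or rank a ≤ q and rank b ≤ q} for q ∈ {−∞, 0, 1, …, n} (so R_n is the universal relation and R_{−∞} is equality); the relations R_N := R_{q−1} ∪ ν_N for 2 ≤ q ≤ n and nontrivial normal subgroups N of S_q; and the four relations μ↑ := R_0 ∪ {(α,β) ∈ D_1 × D_1 : α̂ = β̂ and α R β}, μ↓ := R_0 ∪ {(α,β) ∈ D_1 × D_1 : α̂ = β̂ and α L β}, μ := R_0 ∪ {(α,β) ∈ D_1 × D_1 : α̂ = β̂}, and μ_{S_2} := μ ∪ ν_{S_2}. -/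

import Mathlib

namespace TPM

/-- Vertex set `{1,…,n} ∪ {1',…,n'}`: `Sum.inl` = unprimed (upper row),
`Sum.inr` = primed (lower row). -/
abbrev V (n : ℕ) := Fin n ⊕ Fin n

/-- The partition monoid `P_n`: set partitions of the `2n`-element set `V n`,
encoded as equivalence relations (setoids). -/
abbrev PM (n : ℕ) := Setoid (V n)

/-- Three-row vertex set of the product graph: top / middle / bottom. -/
abbrev W (n : ℕ) := Fin n ⊕ (Fin n ⊕ Fin n)

variable {n : ℕ}

/-- First factor: unprimed ↦ top, primed ↦ middle. -/
def topMid : V n → W n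
  | Sum.inl i => Sum.inl i
  | Sum.inr i => Sum.inr (Sum.inl i)

/-- Second factor: unprimed ↦ middle, primed ↦ bottom. -/
def midBot : V n → W n
  | Sum.inl i => Sum.inr (Sum.inl i)
  | Sum.inr i => Sum.inr (Sum.inr i)

/-- Embedding of `V n` as top and bottom rows of the three-row set. -/
def topBot : V n → W n
  | Sum.inl i => Sum.inl i
  | Sum.inr i => Sum.inr (Sum.inr i)

/-- Edge relation of the product graph `Γ(α,β)`. -/
def graphRel (α β : PM n) (x y : W n) : Prop :=
  (∃ u v : V n, α.r u v ∧ x = topMid u ∧ y = topMid v) ∨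
  (∃ u v : V n, β.r u v ∧ x = midBot u ∧ y = midBot v)

/-- Connectivity (equivalence closure of the edge relation) in `Γ(α,β)`. -/
def conn (α β : PM n) : W n → W n → Prop := Relation.EqvGen (graphRel α β)

/-- Connectivity in `Γ(α,β)`, as a setoid on the three-row vertex set. -/
def connSetoid (α β : PM n) : Setoid (W n) :=
  ⟨conn α β, Relation.EqvGen.is_equivalence _⟩

/-- The product of two partitions: `x,y` lie in the same block of `αβ` iff they are
connected in `Γ(α,β)`. -/
def pmul (α β : PM n) : PM n :=
  ⟨fun x y => conn α β (topBot x) (topBot y),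
    ⟨fun _ => Relation.EqvGen.refl _, fun h => Relation.EqvGen.symm _ _ h, fun h h' => Relation.EqvGen.trans _ _ _ h h'⟩⟩

/-- A vertex of the three-row set lies in the middle row. -/
def isMid (x : W n) : Prop := ∃ i : Fin n, x = Sum.inr (Sum.inl i)

/-- `Φ(α,β)`: the number of floating components of `Γ(α,β)`, i.e. connected components
all of whose vertices lie in the middle row. -/
noncomputable def Phi (α β : PM n) : ℕ :=
  Nat.card {c : Quotient (connSetoid α β) //
    ∀ x : W n, Quotient.mk (connSetoid α β) x = c → isMid x}

/-- The rank of a partition: the number of transversal blocks (blocks containing both an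
unprimed and a primed element). -/
noncomputable def rnk (α : PM n) : ℕ :=
  Nat.card {c : Quotient α //
    (∃ i : Fin n, Quotient.mk α (Sum.inl i) = c) ∧ ∃ i : Fin n, Quotient.mk α (Sum.inr i) = c}

/-- Which row of `V n` a point lies in. -/
def side : V n → Bool
  | Sum.inl _ => true
  | Sum.inr _ => false

/-- `α̂`: split each transversal of `α` into its unprimed part and its primed part. -/
def hat (α : PM n) : PM n :=
  ⟨fun x y => α.r x y ∧ side x = side y,
    ⟨fun x => ⟨α.iseqv.refl x, rfl⟩,
     fun h => ⟨α.iseqv.symm h.1, h.2.symm⟩,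
     fun h h' => ⟨α.iseqv.trans h.1 h'.1, h.2.trans h'.2⟩⟩⟩

/-- The twisted product on `ℕ × P_n`:  `(i,α)(j,β) = (i + j + Φ(α,β), αβ)`. -/
noncomputable def tmul (a b : ℕ × PM n) : ℕ × PM n :=
  (a.1 + b.1 + Phi a.2 b.2, pmul a.2 b.2)

/-- A congruence on a set equipped with a binary operation: an equivalence relation
compatible with the operation on both sides. -/
def IsCongruence {M : Type*} (mul : M → M → M) (σ : M → M → Prop) : Prop :=
  Equivalence σ ∧ ∀ x y a, σ x y → σ (mul a x) (mul a y) ∧ σ (mul x a) (mul y a)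

/-- Green's relation `R`: equality of the right ideals `xM = yM`. -/
def greenR {M : Type*} (mul : M → M → M) (x y : M) : Prop :=
  Set.range (mul x) = Set.range (mul y)

/-- Green's relation `L`: `Mx = My`. -/
def greenL {M : Type*} (mul : M → M → M) (x y : M) : Prop :=
  Set.range (fun a => mul a x) = Set.range (fun a => mul a y)

/-- The principal two-sided ideal `MxM`. -/
def jSet {M : Type*} (mul : M → M → M) (x : M) : Set M :=
  Set.range (fun p : M × M => mul (mul p.1 x) p.2)

/-- Green's relation `J`: `MxM = MyM`. -/
def greenJ {M : Type*} (mul : M → M → M) (x y : M) : Prop :=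
  jSet mul x = jSet mul y

/-- Green's relation `H = R ∩ L`. -/
def greenH {M : Type*} (mul : M → M → M) (x y : M) : Prop :=
  greenR mul x y ∧ greenL mul x y

/-- Green's relation `D = R ∘ L`. -/
def greenD {M : Type*} (mul : M → M → M) (x y : M) : Prop :=
  ∃ z, greenR mul x z ∧ greenL mul z y

/-- `pd(α,β)` satisfies `P`, where `α` has `p` transversals: there are representatives
`a s` of the upper parts of the `p` (pairwise distinct) transversals of `α`, with `b s`
representing the corresponding lower parts, and a permutation `π` with `P π` such that the
block of `β` containing `a s` contains `b (π s)`.  (For H-related `α, β ∈ D_p` this says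
exactly that some representation of the permutational difference `pd(α,β)` satisfies `P`.) -/
def pdIn (p : ℕ) (P : Equiv.Perm (Fin p) → Prop) (α β : PM n) : Prop :=
  ∃ (a b : Fin p → Fin n) (π : Equiv.Perm (Fin p)),
    (∀ s t, α.r (Sum.inl (a s)) (Sum.inl (a t)) → s = t) ∧
    (∀ s, α.r (Sum.inl (a s)) (Sum.inr (b s))) ∧
    (∀ s, β.r (Sum.inl (a s)) (Sum.inr (b (π s)))) ∧
    P π

/-- The relation `ν_N` on `D_p`, for a subgroup `N ≤ S_p`:  H-related pairs of rank-`p`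
partitions whose permutational difference lies in `N`. -/
def nuRel (p : ℕ) (N : Subgroup (Equiv.Perm (Fin p))) (α β : PM n) : Prop :=
  rnk α = p ∧ rnk β = p ∧ greenH pmul α β ∧ pdIn p (· ∈ N) α β

/-- The congruence `(m, m+d)^♯` on the additive monoid `ℕ` (intended for `d ≥ 1`). -/
def natCong (m d : ℕ) (i j : ℕ) : Prop :=
  i = j ∨ (m ≤ i ∧ m ≤ j ∧ i % d = j % d)

/-- `min θ ≤ i` for a congruence `θ` on `ℕ` (with `min Δ_ℕ = ∞`). -/
def minLE (θ : ℕ → ℕ → Prop) (i : ℕ) : Prop :=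
  ∃ a b, θ a b ∧ a ≠ b ∧ a ≤ i

/-- `k ≤ min θ` for a congruence `θ` on `ℕ` (with `min Δ_ℕ = ∞`). -/
def leMin (k : ℕ) (θ : ℕ → ℕ → Prop) : Prop :=
  ∀ a b, θ a b → a ≠ b → k ≤ a

/-- The possible entries of a C-matrix. -/
inductive CEntry : Type
  | delta | muUp | muDown | mu | lam | rho | R
  | nsym (q : ℕ) (N : Subgroup (Equiv.Perm (Fin q)))

/-- Whether a C-matrix entry is an N-symbol. -/
def isNsym : CEntry → Prop
  | CEntry.nsym _ _ => True
  | _ => False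

/-- The allowed values of the symbol `ζ` in row types RT2, RT5, RT6. -/
def isZeta (e : CEntry) : Prop :=
  e = CEntry.mu ∨ e = CEntry.muUp ∨ e = CEntry.muDown ∨ e = CEntry.delta

/-- The allowed values of the symbol `ξ` in row types RT4–RT7: any of `μ,ρ,λ,R` if
`d = 1`, and only `μ` if `d > 1`. -/
def xiOK (d : ℕ) (e : CEntry) : Prop :=
  e = CEntry.mu ∨ (d = 1 ∧ (e = CEntry.rho ∨ e = CEntry.lam ∨ e = CEntry.R))

/-- Row type RT1 for rows 0 and 1: all entries `Δ`. -/
def RT1 (M0 M1 : ℕ → CEntry) : Prop :=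
  (∀ i, M0 i = CEntry.delta) ∧ (∀ i, M1 i = CEntry.delta)

/-- Row type RT2. -/
def RT2 (Θ0 Θ1 : ℕ → ℕ → Prop) (M0 M1 : ℕ → CEntry) : Prop :=
  Θ0 = Eq ∧ Θ1 = Eq ∧
  ∃ i ζ, isZeta ζ ∧
    (∀ j, j < i → M0 j = CEntry.delta) ∧ (∀ j, i ≤ j → M0 j = CEntry.mu) ∧
    (∀ j, j < i → M1 j = CEntry.delta) ∧ M1 i = ζ ∧ (∀ j, i < j → M1 j = CEntry.mu)

/-- Row type RT3. -/
def RT3 (Θ0 : ℕ → ℕ → Prop) (M0 M1 : ℕ → CEntry) : Prop :=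
  ∃ m ξ, Θ0 = natCong m 1 ∧ (ξ = CEntry.rho ∨ ξ = CEntry.lam ∨ ξ = CEntry.R) ∧
    (∀ i, M1 i = CEntry.delta) ∧
    (∀ j, j < m → M0 j = CEntry.delta) ∧ (∀ j, m ≤ j → M0 j = ξ)

/-- Row type RT4. -/
def RT4 (Θ0 Θ1 : ℕ → ℕ → Prop) (M0 M1 : ℕ → CEntry) : Prop :=
  ∃ m d ξ, 1 ≤ d ∧ Θ0 = natCong m d ∧ Θ1 = natCong m d ∧ xiOK d ξ ∧
    (∀ j, j < m → M0 j = CEntry.delta ∧ M1 j = CEntry.delta) ∧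
    (∀ j, m ≤ j → M0 j = ξ ∧ M1 j = ξ)

/-- Row type RT5. -/
def RT5 (Θ0 Θ1 : ℕ → ℕ → Prop) (M0 M1 : ℕ → CEntry) : Prop :=
  ∃ m d i ξ ζ, 1 ≤ d ∧ i < m ∧ Θ0 = natCong m d ∧ Θ1 = natCong (m + 1) d ∧
    xiOK d ξ ∧ isZeta ζ ∧
    (∀ j, j < i → M0 j = CEntry.delta) ∧ (∀ j, i ≤ j → j < m → M0 j = CEntry.mu) ∧
    (∀ j, m ≤ j → M0 j = ξ) ∧
    (∀ j, j < i → M1 j = CEntry.delta) ∧ M1 i = ζ ∧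
    (∀ j, i < j → j ≤ m → M1 j = CEntry.mu) ∧ (∀ j, m < j → M1 j = ξ)

/-- Row type RT6. -/
def RT6 (Θ0 Θ1 : ℕ → ℕ → Prop) (M0 M1 : ℕ → CEntry) : Prop :=
  ∃ m l d ξ ζ, 1 ≤ d ∧ m < l ∧ Θ0 = natCong m d ∧ Θ1 = natCong l d ∧
    xiOK d ξ ∧ isZeta ζ ∧
    (∀ j, j < m → M0 j = CEntry.delta) ∧ (∀ j, m ≤ j → M0 j = ξ) ∧
    (∀ j, j < l - 1 → M1 j = CEntry.delta) ∧ M1 (l - 1) = ζ ∧ (∀ j, l ≤ j → M1 j = ξ)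

/-- Row type RT7. -/
def RT7 (Θ0 Θ1 : ℕ → ℕ → Prop) (M0 M1 : ℕ → CEntry) : Prop :=
  ∃ m l d ξ, 1 ≤ d ∧ 0 < m ∧ m + 1 < l ∧ (l - 1) % d = m % d ∧
    Θ0 = natCong m d ∧ Θ1 = natCong l d ∧ xiOK d ξ ∧
    (∀ j, j < m - 1 → M0 j = CEntry.delta) ∧ M0 (m - 1) = CEntry.mu ∧
    (∀ j, m ≤ j → M0 j = ξ) ∧
    (∀ j, j < l - 1 → M1 j = CEntry.delta) ∧ M1 (l - 1) = CEntry.mu ∧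
    (∀ j, l ≤ j → M1 j = ξ)

/-- Row type RT8 for a row `q ≥ 2`: all entries `Δ`. -/
def RT8 (Mq : ℕ → CEntry) : Prop := ∀ i, Mq i = CEntry.delta

/-- Row type RT9 for a row `q ≥ 2`. -/
def RT9 (q : ℕ) (Θq : ℕ → ℕ → Prop) (Mq : ℕ → CEntry) : Prop :=
  ∃ (i k : ℕ) (Ns : ℕ → Subgroup (Equiv.Perm (Fin q))),
    i ≤ k ∧ leMin k Θq ∧
    (∀ j, i ≤ j → j ≤ k → Ns j ≠ ⊥ ∧ (Ns j).Normal) ∧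
    (∀ j j', i ≤ j → j ≤ j' → j' ≤ k → Ns j ≤ Ns j') ∧
    (∀ j, j < i → Mq j = CEntry.delta) ∧
    (∀ j, i ≤ j → j < k → Mq j = CEntry.nsym q (Ns j)) ∧
    (∀ j, k ≤ j → Mq j = CEntry.nsym q (Ns k))

/-- Row type RT10 for a row `q ≥ 2`. -/
def RT10 (q : ℕ) (Θq : ℕ → ℕ → Prop) (Mq : ℕ → CEntry) : Prop :=
  ∃ (i m : ℕ) (Ns : ℕ → Subgroup (Equiv.Perm (Fin q))),
    i ≤ m ∧ Θq = natCong m 1 ∧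
    (∀ j, i ≤ j → j < m → Ns j ≠ ⊥ ∧ (Ns j).Normal) ∧
    (∀ j j', i ≤ j → j ≤ j' → j' < m → Ns j ≤ Ns j') ∧
    (∀ j, j < i → Mq j = CEntry.delta) ∧
    (∀ j, i ≤ j → j < m → Mq j = CEntry.nsym q (Ns j)) ∧
    (∀ j, m ≤ j → Mq j = CEntry.R)

/-- A C-pair for `P_n^Φ`: a descending chain `Θ = (θ_0 ⊇ ⋯ ⊇ θ_n)` of congruences on
`(ℕ,+)` together with a matrix `M = (M_{qi})`, `0 ≤ q ≤ n`, `i ∈ ℕ`, whose rows 0 and 1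
jointly have one of the types RT1–RT7, whose rows `q ≥ 2` have one of the types RT8–RT10,
and which satisfies the verticality conditions (V1) and (V2). -/
def IsCPair (n : ℕ) (Θ : ℕ → ℕ → ℕ → Prop) (M : ℕ → ℕ → CEntry) : Prop :=
  (∀ q, q ≤ n → IsCongruence (· + ·) (Θ q)) ∧
  (∀ q r, q ≤ r → r ≤ n → ∀ i j, Θ r i j → Θ q i j) ∧
  (RT1 (M 0) (M 1) ∨ RT2 (Θ 0) (Θ 1) (M 0) (M 1) ∨ RT3 (Θ 0) (M 0) (M 1) ∨
    RT4 (Θ 0) (Θ 1) (M 0) (M 1) ∨ RT5 (Θ 0) (Θ 1) (M 0) (M 1) ∨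
    RT6 (Θ 0) (Θ 1) (M 0) (M 1) ∨ RT7 (Θ 0) (Θ 1) (M 0) (M 1)) ∧
  (∀ q, 2 ≤ q → q ≤ n → (RT8 (M q) ∨ RT9 q (Θ q) (M q) ∨ RT10 q (Θ q) (M q))) ∧
  (∀ q i, 1 ≤ q → q ≤ n → isNsym (M q i) →
    ¬(M (q - 1) i = CEntry.delta ∨ M (q - 1) i = CEntry.muUp ∨
      M (q - 1) i = CEntry.muDown ∨ isNsym (M (q - 1) i))) ∧
  (∀ q i, 2 ≤ q → q ≤ n → M q i = CEntry.R → M (q - 1) i = CEntry.R)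

/-- The relation `cg(Θ,M)` on `P_n^Φ` associated with a C-pair `(Θ,M)`: conditions
(C1)–(C8). -/
def cg (n : ℕ) (Θ : ℕ → ℕ → ℕ → Prop) (M : ℕ → ℕ → CEntry)
    (a b : ℕ × PM n) : Prop :=
  -- (C1)
  (M (rnk a.2) a.1 = CEntry.delta ∧ M (rnk b.2) b.1 = CEntry.delta ∧
    Θ (rnk a.2) a.1 b.1 ∧ a.2 = b.2) ∨
  -- (C2)
  (M (rnk a.2) a.1 = CEntry.R ∧ M (rnk b.2) b.1 = CEntry.R) ∨
  -- (C3)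
  (∃ p N, M (rnk a.2) a.1 = CEntry.nsym p N ∧ M (rnk b.2) b.1 = CEntry.nsym p N ∧
    Θ (rnk a.2) a.1 b.1 ∧ rnk a.2 = p ∧ greenH pmul a.2 b.2 ∧ pdIn p (· ∈ N) a.2 b.2) ∨
  -- (C4)
  (M (rnk a.2) a.1 = CEntry.lam ∧ M (rnk b.2) b.1 = CEntry.lam ∧
    greenL pmul (hat a.2) (hat b.2)) ∨
  -- (C5)
  (M (rnk a.2) a.1 = CEntry.rho ∧ M (rnk b.2) b.1 = CEntry.rho ∧
    greenR pmul (hat a.2) (hat b.2)) ∨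
  -- (C6)
  (M (rnk a.2) a.1 = CEntry.muDown ∧ M (rnk b.2) b.1 = CEntry.muDown ∧
    hat a.2 = hat b.2 ∧ greenL pmul a.2 b.2) ∨
  -- (C7)
  (M (rnk a.2) a.1 = CEntry.muUp ∧ M (rnk b.2) b.1 = CEntry.muUp ∧
    hat a.2 = hat b.2 ∧ greenR pmul a.2 b.2) ∨
  -- (C8)
  (M (rnk a.2) a.1 = CEntry.mu ∧ M (rnk b.2) b.1 = CEntry.mu ∧
    hat a.2 = hat b.2 ∧
    ((rnk a.2 = rnk b.2 ∧ Θ (rnk a.2) a.1 b.1) ∨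
     (rnk a.2 ≠ rnk b.2 ∧ Θ 0 (a.1 + rnk b.2) (b.1 + rnk a.2) ∧
        ¬ minLE (Θ (rnk a.2)) a.1 ∧ ¬ minLE (Θ (rnk b.2)) b.1) ∨
     (rnk a.2 ≠ rnk b.2 ∧ Θ 0 (a.1 + rnk b.2) (b.1 + rnk a.2) ∧
        minLE (Θ (rnk a.2)) a.1 ∧ minLE (Θ (rnk b.2)) b.1)))

/-- The C-pair `(Θ,M)` is exceptional with exceptional row `q`, where
`θ_q = (m, m+2d)^♯`. -/
def ExcAt (n : ℕ) (Θ : ℕ → ℕ → ℕ → Prop) (M : ℕ → ℕ → CEntry) (q m d : ℕ) : Prop :=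
  2 ≤ q ∧ q ≤ n ∧ 1 ≤ d ∧ Θ q = natCong m (2 * d) ∧
  ((2 < q ∧ M q m = CEntry.nsym q (alternatingGroup (Fin q))) ∨
   (q = 2 ∧ M 2 m = CEntry.delta ∧
     (M 1 m = CEntry.mu ∨ M 1 m = CEntry.rho ∨ M 1 m = CEntry.lam ∨ M 1 m = CEntry.R) ∧
     (∀ i j, natCong m d i j → Θ 1 i j)))

/-- The exceptional congruence `cgx(Θ,M)` associated with an exceptional C-pair:
`cg(Θ,M)` together with the pairs of (C9). -/
def cgx (n : ℕ) (Θ : ℕ → ℕ → ℕ → Prop) (M : ℕ → ℕ → CEntry) (q m d : ℕ)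
    (a b : ℕ × PM n) : Prop :=
  cg n Θ M a b ∨
  (rnk a.2 = q ∧ rnk b.2 = q ∧ natCong m d a.1 b.1 ∧ ¬ Θ q a.1 b.1 ∧
    greenH pmul a.2 b.2 ∧ pdIn q (fun π => π ∉ alternatingGroup (Fin q)) a.2 b.2)

/-- The Rees relation of a subset `I`. -/
def rees {M : Type*} (I : Set M) (x y : M) : Prop := x = y ∨ (x ∈ I ∧ y ∈ I)

/-- A (possibly empty) ideal of `P_n^Φ`: `MIM ⊆ I`. -/
def tIdeal (n : ℕ) (I : Set (ℕ × PM n)) : Prop :=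
  ∀ a b x, x ∈ I → tmul (tmul a x) b ∈ I

/-- `I(σ)`: the union of all ideals `I` of `P_n^Φ` whose Rees congruence is contained
in `σ`. -/
def Isig (n : ℕ) (σ : (ℕ × PM n) → (ℕ × PM n) → Prop) : Set (ℕ × PM n) :=
  ⋃₀ {I | tIdeal n I ∧ ∀ x y, rees I x y → σ x y}

/-- The 0-twisted partition monoid `P_{n,0}^Φ`, carried by `Option (P_n)` with
`none` the zero element `✗`. -/
noncomputable def mul0 (a b : Option (PM n)) : Option (PM n) :=
  match a, b with
  | some α, some β => if Phi α β = 0 then some (pmul α β) else none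
  | _, _ => none

/-- `rank a ≤ q`, where `rank ✗ = -∞`. -/
def rnkLE (a : Option (PM n)) (q : ℕ) : Prop :=
  ∀ α, a = some α → rnk α ≤ q

/-- The Rees congruence `R_q` on `P_{n,0}^Φ`. -/
def ReesQ (q : ℕ) (a b : Option (PM n)) : Prop :=
  a = b ∨ (rnkLE a q ∧ rnkLE b q)

/-- Lift a relation on `P_n` to `P_{n,0}^Φ = P_n ∪ {✗}`. -/
def lift2 (r : PM n → PM n → Prop) (a b : Option (PM n)) : Prop :=
  ∃ α β, a = some α ∧ b = some β ∧ r α β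



/-- `ν_N`, lifted to `P_{n,0}^Φ`. -/
def nuOpt (p : ℕ) (N : Subgroup (Equiv.Perm (Fin p))) (a b : Option (PM n)) : Prop :=
  lift2 (nuRel p N) a b


/-- upper kernel -/
def U (α : PM n) (i j : Fin n) : Prop := α.r (Sum.inl i) (Sum.inl j)
/-- lower kernel -/
def L (α : PM n) (i j : Fin n) : Prop := α.r (Sum.inr i) (Sum.inr j)
/-- transversal relation -/
def T (α : PM n) (i j : Fin n) : Prop := α.r (Sum.inl i) (Sum.inr j)
/-- domain -/
def Dm (α : PM n) (i : Fin n) : Prop := ∃ j, T α i j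
/-- codomain -/
def Cd (α : PM n) (j : Fin n) : Prop := ∃ i, T α i j

lemma U_refl (α : PM n) (i) : U α i i := α.iseqv.refl _
lemma U_symm {α : PM n} {i j} (h : U α i j) : U α j i := α.iseqv.symm h
lemma U_trans {α : PM n} {i j k} (h : U α i j) (h' : U α j k) : U α i k := α.iseqv.trans h h'
lemma L_refl (α : PM n) (i) : L α i i := α.iseqv.refl _
lemma L_symm {α : PM n} {i j} (h : L α i j) : L α j i := α.iseqv.symm h
lemma L_trans {α : PM n} {i j k} (h : L α i j) (h' : L α j k) : L α i k := α.iseqv.trans h h'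
lemma U_T {α : PM n} {i j k} (h : U α i j) (h' : T α j k) : T α i k := α.iseqv.trans h h'
lemma T_L {α : PM n} {i j k} (h : T α i j) (h' : L α j k) : T α i k := α.iseqv.trans h h'
lemma T_T_U {α : PM n} {i j k} (h : T α i k) (h' : T α j k) : U α i j :=
  α.iseqv.trans h (α.iseqv.symm h')
lemma T_T_L {α : PM n} {i j k} (h : T α i j) (h' : T α i k) : L α j k :=
  α.iseqv.trans (α.iseqv.symm h) h'

lemma PM_ext {α β : PM n} (hU : ∀ i j, U α i j ↔ U β i j) (hL : ∀ i j, L α i j ↔ L β i j)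
    (hT : ∀ i j, T α i j ↔ T β i j) : α = β := by
  apply Setoid.ext
  rintro (i | i) (j | j)
  · exact hU i j
  · exact hT i j
  · have := hT j i
    exact ⟨fun h => β.iseqv.symm (this.1 (α.iseqv.symm h)),
      fun h => α.iseqv.symm (this.2 (β.iseqv.symm h))⟩
  · exact hL i j

/-- middle-row connectivity -/
def E (γ α : PM n) : Fin n → Fin n → Prop :=
  Relation.EqvGen (fun k l => L γ k l ∨ U α k l)

/-- middle-row connectivity as a setoid -/
def ES (γ α : PM n) : Setoid (Fin n) := ⟨E γ α, Relation.EqvGen.is_equivalence _⟩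

lemma E_refl (γ α : PM n) (k) : E γ α k k := Relation.EqvGen.refl _
lemma E_symm {γ α : PM n} {k l} (h : E γ α k l) : E γ α l k := Relation.EqvGen.symm _ _ h
lemma E_trans {γ α : PM n} {k l m} (h : E γ α k l) (h' : E γ α l m) : E γ α k m :=
  Relation.EqvGen.trans _ _ _ h h'
lemma E_L {γ α : PM n} {k l} (h : L γ k l) : E γ α k l := Relation.EqvGen.rel _ _ (Or.inl h)
lemma E_U {γ α : PM n} {k l} (h : U α k l) : E γ α k l := Relation.EqvGen.rel _ _ (Or.inr h)

lemma E_le {γ α : PM n} (r : Fin n → Fin n → Prop) (hr : Equivalence r)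
    (h1 : ∀ k l, L γ k l → r k l) (h2 : ∀ k l, U α k l → r k l) {k l} (h : E γ α k l) : r k l := by
  induction h with
  | rel x y h => exact h.elim (h1 _ _) (h2 _ _)
  | refl x => exact hr.refl x
  | symm x y _ ih => exact hr.symm ih
  | trans x y z _ _ ih1 ih2 => exact hr.trans ih1 ih2

lemma E_map {C : Type*} {γ α : PM n} (f : Fin n → C)
    (h1 : ∀ k l, L γ k l → f k = f l) (h2 : ∀ k l, U α k l → f k = f l) {k l}
    (h : E γ α k l) : f k = f l :=
  E_le (fun k l => f k = f l) ⟨fun _ => rfl, fun h => h.symm, fun h h' => h.trans h'⟩ h1 h2 h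

lemma E_set {γ α : PM n} (X : Fin n → Prop)
    (h1 : ∀ k l, L γ k l → (X k ↔ X l)) (h2 : ∀ k l, U α k l → (X k ↔ X l)) {k l}
    (h : E γ α k l) : X k ↔ X l :=
  E_le (fun k l => X k ↔ X l) ⟨fun _ => Iff.rfl, fun h => h.symm, fun h h' => h.trans h'⟩ h1 h2 h

open Classical in
/-- component labelling of the product graph -/
noncomputable def lab (γ α : PM n) : W n → Quotient (ES γ α) ⊕ (Quotient γ ⊕ Quotient α)
  | Sum.inl i => if h : ∃ k, T γ i k then Sum.inl (Quotient.mk _ h.choose)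
      else Sum.inr (Sum.inl (Quotient.mk _ (Sum.inl i)))
  | Sum.inr (Sum.inl k) => Sum.inl (Quotient.mk _ k)
  | Sum.inr (Sum.inr j) => if h : ∃ k, T α k j then Sum.inl (Quotient.mk _ h.choose)
      else Sum.inr (Sum.inr (Quotient.mk _ (Sum.inr j)))

lemma ES_eq {γ α : PM n} {k l} : (Quotient.mk (ES γ α) k = Quotient.mk (ES γ α) l) ↔ E γ α k l :=
  Quotient.eq (r := ES γ α)

lemma lab_top {γ α : PM n} {i k} (h : T γ i k) :
    lab γ α (Sum.inl i) = Sum.inl (Quotient.mk _ k) := by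
  have hh : ∃ k, T γ i k := ⟨k, h⟩
  simp only [lab, dif_pos hh]
  congr 1
  exact ES_eq.2 (E_L (T_T_L hh.choose_spec h))

lemma lab_bot {γ α : PM n} {j k} (h : T α k j) :
    lab γ α (Sum.inr (Sum.inr j)) = Sum.inl (Quotient.mk _ k) := by
  have hh : ∃ k, T α k j := ⟨k, h⟩
  simp only [lab, dif_pos hh]
  congr 1
  exact ES_eq.2 (E_U (T_T_U hh.choose_spec h))

lemma lab_top' {γ α : PM n} {i} (h : ¬ ∃ k, T γ i k) :
    lab γ α (Sum.inl i) = Sum.inr (Sum.inl (Quotient.mk _ (Sum.inl i))) := by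
  simp only [lab, dif_neg h]

lemma lab_bot' {γ α : PM n} {j} (h : ¬ ∃ k, T α k j) :
    lab γ α (Sum.inr (Sum.inr j)) = Sum.inr (Sum.inr (Quotient.mk _ (Sum.inr j))) := by
  simp only [lab, dif_neg h]

lemma lab_mid {γ α : PM n} {k} :
    lab γ α (Sum.inr (Sum.inl k)) = Sum.inl (Quotient.mk _ k) := rfl

lemma lab_graph {γ α : PM n} {x y : W n} (h : graphRel γ α x y) : lab γ α x = lab γ α y := by
  rcases h with ⟨u, v, h, rfl, rfl⟩ | ⟨u, v, h, rfl, rfl⟩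
  · rcases u with i | i <;> rcases v with j | j <;> simp only [topMid]
    · change U γ i j at h
      by_cases hi : ∃ k, T γ i k
      · obtain ⟨k, hk⟩ := hi
        rw [lab_top hk, lab_top (U_T (U_symm h) hk)]
      · have hj : ¬ ∃ k, T γ j k := fun ⟨k, hk⟩ => hi ⟨k, U_T h hk⟩
        rw [lab_top' hi, lab_top' hj]
        congr 2
        exact Quotient.sound h
    · rw [lab_top h, lab_mid]
    · rw [lab_top (γ.iseqv.symm h), lab_mid]
    · rw [lab_mid, lab_mid]
      exact congrArg _ (ES_eq.2 (E_L h))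
  · rcases u with i | i <;> rcases v with j | j <;> simp only [midBot]
    · rw [lab_mid, lab_mid]
      exact congrArg _ (ES_eq.2 (E_U h))
    · rw [lab_bot h, lab_mid]
    · rw [lab_bot (α.iseqv.symm h), lab_mid]
    · change L α i j at h
      by_cases hi : ∃ k, T α k i
      · obtain ⟨k, hk⟩ := hi
        rw [lab_bot hk, lab_bot (T_L hk h)]
      · have hj : ¬ ∃ k, T α k j := fun ⟨k, hk⟩ => hi ⟨k, T_L hk (L_symm h)⟩
        rw [lab_bot' hi, lab_bot' hj]
        congr 2
        exact Quotient.sound h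

lemma lab_conn {γ α : PM n} {x y : W n} (h : conn γ α x y) : lab γ α x = lab γ α y := by
  induction h with
  | rel x y h => exact lab_graph h
  | refl x => rfl
  | symm x y _ ih => exact ih.symm
  | trans x y z _ _ ih1 ih2 => exact ih1.trans ih2

lemma conn_U {γ α : PM n} {i j} (h : U γ i j) : conn γ α (Sum.inl i) (Sum.inl j) :=
  Relation.EqvGen.rel _ _ (Or.inl ⟨_, _, h, rfl, rfl⟩)
lemma conn_T {γ α : PM n} {i j} (h : T γ i j) : conn γ α (Sum.inl i) (Sum.inr (Sum.inl j)) :=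
  Relation.EqvGen.rel _ _ (Or.inl ⟨_, _, h, rfl, rfl⟩)
lemma conn_T2 {γ α : PM n} {i j} (h : T α i j) :
    conn γ α (Sum.inr (Sum.inl i)) (Sum.inr (Sum.inr j)) :=
  Relation.EqvGen.rel _ _ (Or.inr ⟨_, _, h, rfl, rfl⟩)
lemma conn_L {γ α : PM n} {i j} (h : L α i j) :
    conn γ α (Sum.inr (Sum.inr i)) (Sum.inr (Sum.inr j)) :=
  Relation.EqvGen.rel _ _ (Or.inr ⟨_, _, h, rfl, rfl⟩)
lemma conn_symm {γ α : PM n} {x y} (h : conn γ α x y) : conn γ α y x :=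
  Relation.EqvGen.symm _ _ h
lemma conn_trans {γ α : PM n} {x y z} (h : conn γ α x y) (h' : conn γ α y z) : conn γ α x z :=
  Relation.EqvGen.trans _ _ _ h h'
lemma conn_E {γ α : PM n} {i j} (h : E γ α i j) :
    conn γ α (Sum.inr (Sum.inl i)) (Sum.inr (Sum.inl j)) := by
  refine E_le (fun i j => conn γ α (Sum.inr (Sum.inl i)) (Sum.inr (Sum.inl j)))
    ⟨fun _ => Relation.EqvGen.refl _, conn_symm, conn_trans⟩ ?_ ?_ h
  · intro k l h
    exact Relation.EqvGen.rel _ _ (Or.inl ⟨Sum.inr k, Sum.inr l, h, rfl, rfl⟩)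
  · intro k l h
    exact Relation.EqvGen.rel _ _ (Or.inr ⟨Sum.inl k, Sum.inl l, h, rfl, rfl⟩)

lemma U_mul {γ α : PM n} {i j} : U (pmul γ α) i j ↔
    U γ i j ∨ ∃ k l, T γ i k ∧ E γ α k l ∧ T γ j l := by
  constructor
  · intro h
    have h := lab_conn (show conn γ α (Sum.inl i) (Sum.inl j) from h)
    by_cases hi : ∃ k, T γ i k <;> by_cases hj : ∃ k, T γ j k
    · obtain ⟨k, hk⟩ := hi
      obtain ⟨l, hl⟩ := hj
      rw [lab_top hk, lab_top hl] at h
      exact Or.inr ⟨k, l, hk, ES_eq.1 (Sum.inl_injective h), hl⟩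
    · obtain ⟨k, hk⟩ := hi
      rw [lab_top hk, lab_top' hj] at h
      cases h
    · obtain ⟨k, hk⟩ := hj
      rw [lab_top hk, lab_top' hi] at h
      cases h
    · rw [lab_top' hi, lab_top' hj] at h
      exact Or.inl (Quotient.exact (Sum.inl_injective (Sum.inr_injective h)))
  · rintro (h | ⟨k, l, h1, h2, h3⟩)
    · exact conn_U h
    · exact conn_trans (conn_T h1) (conn_trans (conn_E h2) (conn_symm (conn_T h3)))

lemma T_mul {γ α : PM n} {i j} : T (pmul γ α) i j ↔
    ∃ k l, T γ i k ∧ E γ α k l ∧ T α l j := by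
  constructor
  · intro h
    have h := lab_conn (show conn γ α (Sum.inl i) (Sum.inr (Sum.inr j)) from h)
    by_cases hi : ∃ k, T γ i k <;> by_cases hj : ∃ k, T α k j
    · obtain ⟨k, hk⟩ := hi
      obtain ⟨l, hl⟩ := hj
      rw [lab_top hk, lab_bot hl] at h
      exact ⟨k, l, hk, ES_eq.1 (Sum.inl_injective h), hl⟩
    · obtain ⟨k, hk⟩ := hi
      rw [lab_top hk, lab_bot' hj] at h
      cases h
    · obtain ⟨k, hk⟩ := hj
      rw [lab_bot hk, lab_top' hi] at h
      cases h
    · rw [lab_top' hi, lab_bot' hj] at h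
      cases Sum.inr_injective h
  · rintro ⟨k, l, h1, h2, h3⟩
    exact conn_trans (conn_T h1) (conn_trans (conn_E h2) (conn_T2 h3))

lemma L_mul {γ α : PM n} {i j} : L (pmul γ α) i j ↔
    L α i j ∨ ∃ k l, T α k i ∧ E γ α k l ∧ T α l j := by
  constructor
  · intro h
    have h := lab_conn (show conn γ α (Sum.inr (Sum.inr i)) (Sum.inr (Sum.inr j)) from h)
    by_cases hi : ∃ k, T α k i <;> by_cases hj : ∃ k, T α k j
    · obtain ⟨k, hk⟩ := hi
      obtain ⟨l, hl⟩ := hj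
      rw [lab_bot hk, lab_bot hl] at h
      exact Or.inr ⟨k, l, hk, ES_eq.1 (Sum.inl_injective h), hl⟩
    · obtain ⟨k, hk⟩ := hi
      rw [lab_bot hk, lab_bot' hj] at h
      cases h
    · obtain ⟨k, hk⟩ := hj
      rw [lab_bot hk, lab_bot' hi] at h
      cases h
    · rw [lab_bot' hi, lab_bot' hj] at h
      exact Or.inl (Quotient.exact (Sum.inr_injective (Sum.inr_injective h)))
  · rintro (h | ⟨k, l, h1, h2, h3⟩)
    · exact conn_L h
    · exact conn_trans (conn_symm (conn_T2 h1)) (conn_trans (conn_E h2) (conn_T2 h3))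

lemma Phi_zero {γ α : PM n} : Phi γ α = 0 ↔ ∀ k, ∃ l, E γ α k l ∧ (Cd γ l ∨ Dm α l) := by
  unfold Phi
  rw [Finite.card_eq_zero_iff, isEmpty_subtype]
  constructor
  · intro h k
    have := h (Quotient.mk _ (Sum.inr (Sum.inl k)))
    push Not at this
    obtain ⟨x, hx, hm⟩ := this
    have hx : conn γ α x (Sum.inr (Sum.inl k)) := Quotient.exact hx
    have h := lab_conn hx
    rw [lab_mid] at h
    rcases x with i | i | j
    · by_cases hi : ∃ k, T γ i k
      · obtain ⟨l, hl⟩ := hi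
        rw [lab_top hl] at h
        exact ⟨l, E_symm (ES_eq.1 (Sum.inl_injective h)), Or.inl ⟨i, hl⟩⟩
      · rw [lab_top' hi] at h
        cases h
    · exact absurd ⟨i, rfl⟩ hm
    · by_cases hi : ∃ k, T α k j
      · obtain ⟨l, hl⟩ := hi
        rw [lab_bot hl] at h
        exact ⟨l, E_symm (ES_eq.1 (Sum.inl_injective h)), Or.inr ⟨j, hl⟩⟩
      · rw [lab_bot' hi] at h
        cases h
  · intro h c hc
    induction c using Quotient.inductionOn with
    | h x =>
      obtain ⟨k, rfl⟩ := hc x rfl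
      obtain ⟨l, hE, ⟨i, hi⟩ | ⟨j, hj⟩⟩ := h k
      · have : conn γ α (Sum.inl i) (Sum.inr (Sum.inl k)) :=
          conn_trans (conn_T hi) (conn_E (E_symm hE))
        obtain ⟨m, hm⟩ := hc _ (Quotient.sound this)
        cases hm
      · have : conn γ α (Sum.inr (Sum.inr j)) (Sum.inr (Sum.inl k)) :=
          conn_trans (conn_symm (conn_T2 hj)) (conn_E (E_symm hE))
        obtain ⟨m, hm⟩ := hc _ (Quotient.sound this)
        cases hm



/-- the anti-involution exchanging the two rows -/
def fl (α : PM n) : PM n := Setoid.comap Sum.swap α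

lemma U_fl {α : PM n} {i j} : U (fl α) i j ↔ L α i j := Iff.rfl
lemma L_fl {α : PM n} {i j} : L (fl α) i j ↔ U α i j := Iff.rfl
lemma T_fl {α : PM n} {i j} : T (fl α) i j ↔ T α j i :=
  ⟨fun h => α.iseqv.symm h, fun h => α.iseqv.symm h⟩
lemma Dm_fl {α : PM n} {i} : Dm (fl α) i ↔ Cd α i := by simp only [Dm, Cd, T_fl]
lemma Cd_fl {α : PM n} {i} : Cd (fl α) i ↔ Dm α i := by simp only [Dm, Cd, T_fl]

lemma fl_fl (α : PM n) : fl (fl α) = α :=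
  PM_ext (fun _ _ => Iff.rfl) (fun _ _ => Iff.rfl) (fun _ _ => by rw [T_fl, T_fl])

lemma fl_inj {α β : PM n} : fl α = fl β ↔ α = β :=
  ⟨fun h => by rw [← fl_fl α, h, fl_fl], fun h => by rw [h]⟩

lemma E_fl {γ α : PM n} {k l} : E (fl α) (fl γ) k l ↔ E γ α k l := by
  constructor
  · intro h
    exact E_le (E γ α) ⟨E_refl _ _, E_symm, E_trans⟩ (fun _ _ h => E_U (L_fl.1 h))
      (fun _ _ h => E_L (U_fl.1 h)) h
  · intro h
    exact E_le (E (fl α) (fl γ)) ⟨E_refl _ _, E_symm, E_trans⟩ (fun _ _ h => E_U (U_fl.2 h))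
      (fun _ _ h => E_L (L_fl.2 h)) h

lemma pmul_fl (γ α : PM n) : pmul (fl α) (fl γ) = fl (pmul γ α) := by
  apply PM_ext
  · intro i j
    rw [U_mul, U_fl, U_fl, L_mul]
    simp only [T_fl, E_fl]
  · intro i j
    rw [L_mul, L_fl, L_fl, U_mul]
    simp only [T_fl, E_fl]
  · intro i j
    rw [T_mul, T_fl, T_mul]
    simp only [T_fl, E_fl]
    exact ⟨fun ⟨k, l, h1, h2, h3⟩ => ⟨l, k, h3, E_symm h2, h1⟩,
      fun ⟨k, l, h1, h2, h3⟩ => ⟨l, k, h3, E_symm h2, h1⟩⟩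

lemma Phi_fl (γ α : PM n) : Phi (fl α) (fl γ) = 0 ↔ Phi γ α = 0 := by
  rw [Phi_zero, Phi_zero]
  simp only [E_fl, Dm_fl, Cd_fl, or_comm]

lemma mul0_some {γ α : PM n} (h : Phi γ α = 0) :
    mul0 (some γ) (some α) = some (pmul γ α) := by simp [mul0, h]
lemma mul0_float {γ α : PM n} (h : Phi γ α ≠ 0) :
    mul0 (some γ) (some α) = none := by simp [mul0, h]
@[simp] lemma mul0_none_left (a : Option (PM n)) : mul0 none a = none := by
  cases a <;> simp [mul0]
@[simp] lemma mul0_none_right (a : Option (PM n)) : mul0 a none = none := by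
  cases a <;> simp [mul0]

lemma mul0_fl (a b : Option (PM n)) :
    mul0 (b.map fl) (a.map fl) = (mul0 a b).map fl := by
  rcases a with _ | α <;> rcases b with _ | β <;> simp
  by_cases h : Phi α β = 0
  · rw [mul0_some h, mul0_some ((Phi_fl _ _).2 h), pmul_fl]; rfl
  · rw [mul0_float h, mul0_float (fun h' => h ((Phi_fl _ _).1 h'))]; rfl

lemma map_fl_fl (a : Option (PM n)) : (a.map fl).map fl = a := by
  cases a <;> simp [fl_fl]

/-- the dual relation -/
def dual (σ : Option (PM n) → Option (PM n) → Prop) (a b : Option (PM n)) : Prop :=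
  σ (a.map fl) (b.map fl)

lemma dual_cong {σ : Option (PM n) → Option (PM n) → Prop} (h : IsCongruence mul0 σ) :
    IsCongruence mul0 (dual σ) := by
  refine ⟨⟨fun _ => h.1.refl _, fun h' => h.1.symm h', fun h1 h2 => h.1.trans h1 h2⟩, ?_⟩
  intro x y a hxy
  unfold dual
  rw [← mul0_fl, ← mul0_fl, ← mul0_fl, ← mul0_fl]
  exact (h.2 _ _ (a.map fl) hxy).symm

/-! ### rank -/

lemma rnk_ge {α : PM n} {Q : ℕ} : Q ≤ rnk α ↔ ∃ a b : Fin Q → Fin n,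
    (∀ s t, U α (a s) (a t) → s = t) ∧ ∀ s, T α (a s) (b s) := by
  unfold rnk
  constructor
  · intro h
    set S := {c : Quotient α // (∃ i : Fin n, Quotient.mk α (Sum.inl i) = c) ∧
      ∃ i : Fin n, Quotient.mk α (Sum.inr i) = c}
    let e : S ≃ Fin (Nat.card S) := Finite.equivFin S
    have h1 : ∀ s : Fin Q, ∃ i, Quotient.mk α (Sum.inl i) = (e.symm (Fin.castLE h s)).1 :=
      fun s => (e.symm (Fin.castLE h s)).2.1
    have h2 : ∀ s : Fin Q, ∃ i, Quotient.mk α (Sum.inr i) = (e.symm (Fin.castLE h s)).1 :=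
      fun s => (e.symm (Fin.castLE h s)).2.2
    choose a ha using h1
    choose b hb using h2
    refine ⟨a, b, fun s t hst => ?_, fun s => ?_⟩
    · have : Quotient.mk α (Sum.inl (a s)) = Quotient.mk α (Sum.inl (a t)) := Quotient.sound hst
      rw [ha, ha] at this
      exact Fin.castLE_injective h (e.symm.injective (Subtype.ext this))
    · exact Quotient.exact ((ha s).trans (hb s).symm)
  · rintro ⟨a, b, h1, h2⟩
    rw [← Nat.card_fin Q]
    refine Nat.card_le_card_of_injective
      (fun s => ⟨Quotient.mk α (Sum.inl (a s)), ⟨_, rfl⟩, b s, ?_⟩) ?_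
    · exact (Quotient.sound (h2 s)).symm
    · intro s t hst
      exact h1 s t (Quotient.exact (Subtype.ext_iff.1 hst))

lemma rnk_ge' {α : PM n} {Q : ℕ} : Q ≤ rnk α ↔ ∃ a : Fin Q → Fin n,
    (∀ s t, U α (a s) (a t) → s = t) ∧ ∀ s, Dm α (a s) := by
  rw [rnk_ge]
  constructor
  · rintro ⟨a, b, h1, h2⟩
    exact ⟨a, h1, fun s => ⟨_, h2 s⟩⟩
  · rintro ⟨a, h1, h2⟩
    choose b hb using h2
    exact ⟨a, b, h1, hb⟩

lemma rnk_congr {α β : PM n} (hU : ∀ i j, U α i j ↔ U β i j) (hD : ∀ i, Dm α i ↔ Dm β i) :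
    rnk α = rnk β := by
  have : ∀ Q, Q ≤ rnk α ↔ Q ≤ rnk β := by
    intro Q
    rw [rnk_ge', rnk_ge']
    simp only [hU, hD]
  exact le_antisymm ((this _).1 le_rfl) ((this _).2 le_rfl)

lemma rnk_le (α : PM n) : rnk α ≤ n := by
  obtain ⟨a, b, h1, h2⟩ := rnk_ge.1 (le_refl (rnk α))
  have : Function.Injective a := fun s t h => h1 s t (by rw [h]; exact U_refl _ _)
  simpa using Fintype.card_le_of_injective a this

lemma rnk_fl_le (α : PM n) : rnk α ≤ rnk (fl α) := by
  obtain ⟨a, b, h1, h2⟩ := rnk_ge.1 (le_refl (rnk α))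
  refine rnk_ge.2 ⟨b, a, fun s t h => h1 s t ?_, fun s => T_fl.2 (h2 s)⟩
  exact T_T_U (T_L (h2 s) h) (h2 t)

lemma rnk_fl (α : PM n) : rnk (fl α) = rnk α :=
  le_antisymm (by simpa [fl_fl] using rnk_fl_le (fl α)) (rnk_fl_le α)

lemma rnk_complete {α : PM n} {Q : ℕ} (h : rnk α ≤ Q) {a : Fin Q → Fin n}
    (h1 : ∀ s t, U α (a s) (a t) → s = t) (h2 : ∀ s, Dm α (a s)) {i} (hi : Dm α i) :
    ∃ s, U α i (a s) := by
  by_contra hc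
  push Not at hc
  have : Q + 1 ≤ rnk α := by
    refine rnk_ge'.2 ⟨Fin.cons i a, ?_, ?_⟩
    · intro s t
      refine Fin.cases ?_ (fun s => ?_) s <;> refine Fin.cases ?_ (fun t => ?_) t
      · simp
      · intro h; simp at h; exact absurd h (hc t)
      · intro h; simp at h; exact absurd (U_symm h) (hc s)
      · intro h; simp at h; rw [h1 s t h]
    · intro s
      refine Fin.cases ?_ (fun s => ?_) s
      · simpa using hi
      · simpa using h2 s
  omega

lemma rnk_pos {α : PM n} : 1 ≤ rnk α ↔ ∃ i j, T α i j := by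
  rw [rnk_ge]
  constructor
  · rintro ⟨a, b, h1, h2⟩
    exact ⟨_, _, h2 0⟩
  · rintro ⟨i, j, h⟩
    exact ⟨fun _ => i, fun _ => j, fun s t _ => Subsingleton.elim _ _, fun _ => h⟩

lemma rnk_two {α : PM n} : 2 ≤ rnk α ↔ ∃ i j, Dm α i ∧ Dm α j ∧ ¬ U α i j := by
  rw [rnk_ge']
  constructor
  · rintro ⟨a, h1, h2⟩
    exact ⟨_, _, h2 0, h2 1, fun h => by simpa using h1 _ _ h⟩
  · rintro ⟨i, j, hi, hj, h⟩
    refine ⟨![i, j], ?_, ?_⟩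
    · intro s t
      fin_cases s <;> fin_cases t <;> simp
      · exact h
      · exact fun h' => h (U_symm h')
    · intro s
      fin_cases s <;> simpa

lemma rnk_one {α : PM n} (h : rnk α ≤ 1) {i j} (hi : Dm α i) (hj : Dm α j) : U α i j := by
  by_contra hc
  have := rnk_two.2 ⟨i, j, hi, hj, hc⟩
  omega

lemma rnk_mul_left (γ α : PM n) : rnk (pmul γ α) ≤ rnk γ := by
  obtain ⟨a, b, h1, h2⟩ := rnk_ge.1 (le_refl (rnk (pmul γ α)))
  refine rnk_ge'.2 ⟨a, fun s t h => h1 s t (U_mul.2 (Or.inl h)), fun s => ?_⟩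
  obtain ⟨k, l, h, _⟩ := T_mul.1 (h2 s)
  exact ⟨k, h⟩

lemma rnk_mul_right (γ α : PM n) : rnk (pmul γ α) ≤ rnk α := by
  have := rnk_mul_left (fl α) (fl γ)
  rwa [pmul_fl, rnk_fl, rnk_fl] at this

/-! ### Green's relations -/

lemma range_pmul (α x : PM n) : x ∈ Set.range (pmul α) ↔
    (∀ i j, U α i j → U x i j) ∧ ∀ i, ¬ Dm α i → ¬ Dm x i ∧ ∀ j, U x i j → U α i j := by
  constructor
  · rintro ⟨γ, rfl⟩
    refine ⟨fun i j h => U_mul.2 (Or.inl h), fun i hi => ⟨?_, ?_⟩⟩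
    · rintro ⟨j, hj⟩
      obtain ⟨k, l, h, _⟩ := T_mul.1 hj
      exact hi ⟨k, h⟩
    · intro j hj
      rcases U_mul.1 hj with h | ⟨k, l, h, _⟩
      · exact h
      · exact absurd ⟨k, h⟩ hi
  · rintro ⟨hU, hD⟩
    classical
    let f : Fin n → Quotient x ⊕ Unit := fun k =>
      if h : ∃ i, T α i k then Sum.inl (Quotient.mk x (Sum.inl h.choose)) else Sum.inr ()
    have hf : ∀ {i k}, T α i k → f k = Sum.inl (Quotient.mk x (Sum.inl i)) := by
      intro i k h
      have hh : ∃ i, T α i k := ⟨i, h⟩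
      simp only [f, dif_pos hh]
      exact congrArg _ (Quotient.sound (hU _ _ (T_T_U hh.choose_spec h)))
    have hf' : ∀ {k}, ¬ Cd α k → f k = Sum.inr () := by
      intro k h
      exact dif_neg h
    let g : Fin n → Quotient x ⊕ Unit := fun j => Sum.inl (Quotient.mk x (Sum.inr j))
    let γ : PM n := Setoid.ker (Sum.elim f g)
    have hE : ∀ {k l}, E α γ k l → f k = f l := by
      intro k l h
      refine E_map f ?_ (fun k l h => h) h
      intro k l h
      by_cases hk : Cd α k
      · obtain ⟨i, hi⟩ := hk
        rw [hf hi, hf (T_L hi h)]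
      · have hl : ¬ Cd α l := fun ⟨i, hi⟩ => hk ⟨i, T_L hi (L_symm h)⟩
        rw [hf' hk, hf' hl]
    refine ⟨γ, PM_ext ?_ ?_ ?_⟩
    · intro i j
      rw [U_mul]
      constructor
      · rintro (h | ⟨k, l, h1, h2, h3⟩)
        · exact hU _ _ h
        · have := hE h2
          rw [hf h1, hf h3] at this
          exact Quotient.exact (Sum.inl_injective this)
      · intro h
        by_cases hi : Dm α i
        · by_cases hj : Dm α j
          · obtain ⟨k, hk⟩ := hi
            obtain ⟨l, hl⟩ := hj
            refine Or.inr ⟨k, l, hk, E_U ?_, hl⟩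
            change f k = f l
            rw [hf hk, hf hl]
            exact congrArg _ (Quotient.sound h)
          · exact Or.inl (U_symm ((hD j hj).2 _ (U_symm h)))
        · exact Or.inl ((hD i hi).2 _ h)
    · intro i j
      rw [L_mul]
      constructor
      · rintro (h | ⟨k, l, h1, h2, h3⟩)
        · exact Quotient.exact (Sum.inl_injective (show g i = g j from h))
        · have h1 : f k = g i := h1
          have h3 : f l = g j := h3
          have := h1.symm.trans ((hE h2).trans h3)
          exact Quotient.exact (Sum.inl_injective this)
      · intro h
        exact Or.inl (show g i = g j from congrArg Sum.inl (Quotient.sound h))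
    · intro i j
      rw [T_mul]
      constructor
      · rintro ⟨k, l, h1, h2, h3⟩
        have h3 : f l = g j := h3
        have := (hf h1).symm.trans ((hE h2).trans h3)
        exact Quotient.exact (Sum.inl_injective this)
      · intro h
        by_cases hi : Dm α i
        · obtain ⟨k, hk⟩ := hi
          refine ⟨k, k, hk, E_refl _ _ _, ?_⟩
          change f k = g j
          rw [hf hk]
          exact congrArg _ (Quotient.sound h)
        · exact absurd ⟨j, h⟩ (hD i hi).1

lemma greenR_iff {α β : PM n} : greenR pmul α β ↔
    (∀ i j, U α i j ↔ U β i j) ∧ ∀ i, Dm α i ↔ Dm β i := by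
  constructor
  · intro h
    have h1 : α ∈ Set.range (pmul β) := by
      rw [← h, range_pmul]
      exact ⟨fun _ _ h => h, fun i h => ⟨h, fun _ h => h⟩⟩
    have h2 : β ∈ Set.range (pmul α) := by
      rw [h, range_pmul]
      exact ⟨fun _ _ h => h, fun i h => ⟨h, fun _ h => h⟩⟩
    rw [range_pmul] at h1 h2
    exact ⟨fun i j => ⟨h2.1 i j, h1.1 i j⟩,
      fun i => ⟨fun h => by_contra fun h' => (h1.2 i h').1 h,
        fun h => by_contra fun h' => (h2.2 i h').1 h⟩⟩
  · rintro ⟨hU, hD⟩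
    ext x
    rw [range_pmul, range_pmul]
    simp only [hU, hD]

lemma greenL_fl {α β : PM n} : greenL pmul α β ↔ greenR pmul (fl α) (fl β) := by
  have key : ∀ α : PM n, Set.range (pmul (fl α)) = fl '' Set.range (fun a => pmul a α) := by
    intro α
    ext x
    constructor
    · rintro ⟨γ, rfl⟩
      exact ⟨_, ⟨fl γ, rfl⟩, by rw [← pmul_fl, fl_fl]⟩
    · rintro ⟨_, ⟨γ, rfl⟩, rfl⟩
      exact ⟨fl γ, by rw [pmul_fl]⟩
  have inj : Function.Injective (fl (n := n)) := fun a b h => fl_inj.1 h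
  unfold greenL greenR
  rw [key, key, inj.image_injective.eq_iff]

lemma greenL_iff {α β : PM n} : greenL pmul α β ↔
    (∀ i j, L α i j ↔ L β i j) ∧ ∀ i, Cd α i ↔ Cd β i := by
  rw [greenL_fl, greenR_iff]
  simp only [U_fl, Dm_fl]

lemma greenH_iff {α β : PM n} : greenH pmul α β ↔
    ((∀ i j, U α i j ↔ U β i j) ∧ ∀ i, Dm α i ↔ Dm β i) ∧
    ((∀ i j, L α i j ↔ L β i j) ∧ ∀ i, Cd α i ↔ Cd β i) := by
  unfold greenH
  rw [greenR_iff, greenL_iff]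

lemma hat_iff {α β : PM n} : hat α = hat β ↔
    (∀ i j, U α i j ↔ U β i j) ∧ (∀ i j, L α i j ↔ L β i j) := by
  have hU : ∀ (α : PM n) i j, U (hat α) i j ↔ U α i j := fun α i j =>
    ⟨fun h => h.1, fun h => ⟨h, rfl⟩⟩
  have hL : ∀ (α : PM n) i j, L (hat α) i j ↔ L α i j := fun α i j =>
    ⟨fun h => h.1, fun h => ⟨h, rfl⟩⟩
  have hT : ∀ (α : PM n) i j, ¬ T (hat α) i j := fun α i j h => by
    have := h.2
    simp [side] at this
  constructor
  · intro h
    exact ⟨fun i j => by rw [← hU, h, hU], fun i j => by rw [← hL, h, hL]⟩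
  · rintro ⟨h1, h2⟩
    apply PM_ext
    · intro i j; rw [hU, hU, h1]
    · intro i j; rw [hL, hL, h2]
    · intro i j; exact ⟨fun h => absurd h (hT _ _ _), fun h => absurd h (hT _ _ _)⟩



/-- partition with prescribed block labels of the two rows -/
def mk {C : Type*} (u l : Fin n → C) : PM n := Setoid.ker (Sum.elim u l)

lemma U_mk {C : Type*} {u l : Fin n → C} {i j} : U (mk u l) i j ↔ u i = u j := Iff.rfl
lemma L_mk {C : Type*} {u l : Fin n → C} {i j} : L (mk u l) i j ↔ l i = l j := Iff.rfl
lemma T_mk {C : Type*} {u l : Fin n → C} {i j} : T (mk u l) i j ↔ u i = l j := Iff.rfl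
lemma fl_mk {C : Type*} (u l : Fin n → C) : fl (mk u l) = mk l u :=
  PM_ext (fun _ _ => Iff.rfl) (fun _ _ => Iff.rfl) (fun i j => by rw [T_fl, T_mk, T_mk, eq_comm])

section LM
variable {C : Type*} {u l : Fin n → C} {α : PM n}

lemma E_mk (hl : ∀ i j, U α i j → l i = l j) {i j} : E (mk u l) α i j ↔ l i = l j :=
  ⟨fun h => E_map l (fun _ _ h => L_mk.1 h) hl h, fun h => E_L h⟩

lemma LM_Phi (hl : ∀ i j, U α i j → l i = l j) :
    Phi (mk u l) α = 0 ↔ ∀ k, (∃ i, u i = l k) ∨ ∃ k', l k' = l k ∧ Dm α k' := by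
  rw [Phi_zero]
  refine forall_congr' fun k => ?_
  simp only [E_mk hl]
  constructor
  · rintro ⟨k', h, ⟨i, hi⟩ | h'⟩
    · exact Or.inl ⟨i, (T_mk.1 hi).trans h.symm⟩
    · exact Or.inr ⟨k', h.symm, h'⟩
  · rintro (⟨i, hi⟩ | ⟨k', h, h'⟩)
    · exact ⟨k, rfl, Or.inl ⟨i, hi⟩⟩
    · exact ⟨k', h.symm, Or.inr h'⟩

lemma LM_U (hl : ∀ i j, U α i j → l i = l j) {i j} :
    U (pmul (mk u l) α) i j ↔ u i = u j := by
  rw [U_mul]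
  simp only [E_mk hl, U_mk, T_mk]
  constructor
  · rintro (h | ⟨k, k', h1, h2, h3⟩)
    · exact h
    · rw [h1, h2, h3]
  · exact Or.inl

lemma LM_T (hl : ∀ i j, U α i j → l i = l j) {i j} :
    T (pmul (mk u l) α) i j ↔ ∃ k, u i = l k ∧ T α k j := by
  rw [T_mul]
  simp only [E_mk hl, T_mk]
  constructor
  · rintro ⟨k, k', h1, h2, h3⟩
    exact ⟨k', h1.trans h2, h3⟩
  · rintro ⟨k, h1, h2⟩
    exact ⟨k, k, h1, rfl, h2⟩

lemma LM_L (hl : ∀ i j, U α i j → l i = l j) {i j} :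
    L (pmul (mk u l) α) i j ↔ L α i j ∨ ∃ k k', T α k i ∧ l k = l k' ∧ T α k' j := by
  rw [L_mul]
  simp only [E_mk hl]

lemma RM_Phi (hl : ∀ i j, L α i j → l i = l j) :
    Phi α (mk l u) = 0 ↔ ∀ k, (∃ i, u i = l k) ∨ ∃ k', l k' = l k ∧ Cd α k' := by
  rw [← Phi_fl, fl_mk, LM_Phi (α := fl α) hl]
  simp only [Dm_fl]

lemma RM_L (hl : ∀ i j, L α i j → l i = l j) {i j} :
    L (pmul α (mk l u)) i j ↔ u i = u j := by
  rw [← U_fl, ← pmul_fl, fl_mk, LM_U (α := fl α) hl]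

lemma RM_T (hl : ∀ i j, L α i j → l i = l j) {i j} :
    T (pmul α (mk l u)) i j ↔ ∃ k, T α i k ∧ l k = u j := by
  rw [← T_fl, ← pmul_fl, fl_mk, LM_T (α := fl α) hl]
  simp only [T_fl, and_comm, eq_comm]

lemma RM_U (hl : ∀ i j, L α i j → l i = l j) {i j} :
    U (pmul α (mk l u)) i j ↔ U α i j ∨ ∃ k k', T α i k ∧ l k = l k' ∧ T α j k' := by
  rw [← L_fl, ← pmul_fl, fl_mk, LM_L (α := fl α) hl]
  simp only [T_fl, L_fl]

end LM

/-- two sided multiplication -/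
lemma two {C C' : Type*} {u l : Fin n → C} {v w : Fin n → C'} {α : PM n}
    (hl : ∀ i j, U α i j → l i = l j) (hv : ∀ i j, L α i j → v i = v j)
    (hT : ∀ k j k' j', T α k j → T α k' j' → (l k = l k' ↔ v j = v j'))
    (h1 : ∀ k, (∃ i, u i = l k) ∨ ∃ k', l k' = l k ∧ Dm α k')
    (h2 : ∀ j, (∃ j', w j' = v j) ∨ ∃ i k j', u i = l k ∧ T α k j' ∧ v j' = v j) :
    ∃ ζ, mul0 (mul0 (some (mk u l)) (some α)) (some (mk v w)) = some ζ ∧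
      (∀ i i', U ζ i i' ↔ u i = u i') ∧
      (∀ i j', T ζ i j' ↔ ∃ k j, u i = l k ∧ T α k j ∧ v j = w j') ∧
      (∀ j j', L ζ j j' ↔ w j = w j') := by
  have hv' : ∀ i j, L (pmul (mk u l) α) i j → v i = v j := by
    intro i j h
    rcases (LM_L hl).1 h with h | ⟨k, k', ha, hb, hc⟩
    · exact hv _ _ h
    · exact (hT _ _ _ _ ha hc).1 hb
  refine ⟨pmul (pmul (mk u l) α) (mk v w), ?_, ?_, ?_, ?_⟩
  · rw [mul0_some ((LM_Phi hl).2 h1), mul0_some ((RM_Phi hv').2 ?_)]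
    intro j
    rcases h2 j with h | ⟨i, k, j', ha, hb, hc⟩
    · exact Or.inl h
    · exact Or.inr ⟨j', hc, i, (LM_T hl).2 ⟨k, ha, hb⟩⟩
  · intro i i'
    rw [RM_U hv', LM_U hl]
    constructor
    · rintro (h | ⟨k, k', ha, hb, hc⟩)
      · exact h
      · obtain ⟨x, hx, hx'⟩ := (LM_T hl).1 ha
        obtain ⟨y, hy, hy'⟩ := (LM_T hl).1 hc
        rw [hx, hy]
        exact (hT _ _ _ _ hx' hy').2 hb
    · exact Or.inl
  · intro i j'
    rw [RM_T hv']
    constructor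
    · rintro ⟨j, ha, hb⟩
      obtain ⟨x, hx, hx'⟩ := (LM_T hl).1 ha
      exact ⟨x, j, hx, hx', hb⟩
    · rintro ⟨k, j, ha, hb, hc⟩
      exact ⟨j, (LM_T hl).2 ⟨k, ha, hb⟩, hc⟩
  · intro j j'
    rw [RM_L hv']

lemma two' {C C' : Type*} {u l : Fin n → C} {v w : Fin n → C'} {α ζ : PM n}
    (hl : ∀ i j, U α i j → l i = l j) (hv : ∀ i j, L α i j → v i = v j)
    (hT : ∀ k j k' j', T α k j → T α k' j' → (l k = l k' ↔ v j = v j'))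
    (h1 : ∀ k, (∃ i, u i = l k) ∨ ∃ k', l k' = l k ∧ Dm α k')
    (h2 : ∀ j, (∃ j', w j' = v j) ∨ ∃ i k j', u i = l k ∧ T α k j' ∧ v j' = v j)
    (gU : ∀ i i', U ζ i i' ↔ u i = u i')
    (gT : ∀ i j', T ζ i j' ↔ ∃ k j, u i = l k ∧ T α k j ∧ v j = w j')
    (gL : ∀ j j', L ζ j j' ↔ w j = w j') :
    mul0 (mul0 (some (mk u l)) (some α)) (some (mk v w)) = some ζ := by
  obtain ⟨ζ', h, hU, hT', hL⟩ := two hl hv hT h1 h2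
  rw [h]
  congr 1
  exact PM_ext (fun i j => by rw [hU, gU]) (fun i j => by rw [hL, gL]) (fun i j => by rw [hT', gT])

section eps
variable {Q : ℕ}

/-- the standard rank Q elements -/
def eps (f : Fin n → Fin Q) (π : Equiv.Perm (Fin Q)) : PM n := mk (fun i => π (f i)) f

lemma U_eps {f : Fin n → Fin Q} {π} {i j} : U (eps f π) i j ↔ f i = f j := by
  simp [eps, U_mk]
lemma L_eps {f : Fin n → Fin Q} {π} {i j} : L (eps f π) i j ↔ f i = f j := by
  simp [eps, L_mk]
lemma T_eps {f : Fin n → Fin Q} {π} {i j} : T (eps f π) i j ↔ π (f i) = f j := by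
  simp [eps, T_mk]

lemma down {f : Fin n → Fin Q} (hf : Function.Surjective f) {c d : Fin n → Fin Q}
    {α : PM n} {π : Equiv.Perm (Fin Q)}
    (hc : ∀ i j, U α i j → c i = c j) (hd : ∀ i j, L α i j → d i = d j)
    (hT : ∀ k j, T α k j → d j = π (c k)) (hs : ∀ s, ∃ k j, T α k j ∧ c k = s) :
    mul0 (mul0 (some (mk f c)) (some α)) (some (mk d f)) = some (eps f π) := by
  refine two' hc hd ?_ ?_ ?_ ?_ ?_ ?_
  · intro k j k' j' h h'
    rw [hT _ _ h, hT _ _ h', π.injective.eq_iff]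
  · intro k
    exact Or.inl (hf _)
  · intro j
    exact Or.inl (hf _)
  · intro i i'; exact U_eps
  · intro i j
    rw [T_eps]
    constructor
    · intro h
      obtain ⟨k, j', h1, h2⟩ := hs (f i)
      exact ⟨k, j', h2.symm, h1, by rw [hT _ _ h1, h2, h]⟩
    · rintro ⟨k, j', h1, h2, h3⟩
      rw [h1, ← h3, hT _ _ h2]
  · intro i i'; exact L_eps

/-- labels of points by a family of representatives -/
noncomputable def labU (β : PM n) (a : Fin Q → Fin n) (i : Fin n) : Fin Q ⊕ Quotient β :=
  open Classical in
  if h : ∃ s, U β i (a s) then Sum.inl h.choose else Sum.inr (Quotient.mk β (Sum.inl i))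

lemma labU_pos {β : PM n} {a : Fin Q → Fin n} (ha : ∀ s t, U β (a s) (a t) → s = t) {i s}
    (h : U β i (a s)) : labU β a i = Sum.inl s := by
  have hh : ∃ s, U β i (a s) := ⟨s, h⟩
  unfold labU
  rw [dif_pos hh]
  exact congrArg _ (ha _ _ (U_trans (U_symm hh.choose_spec) h))

lemma labU_neg {β : PM n} {a : Fin Q → Fin n} {i}
    (h : ¬ ∃ s, U β i (a s)) : labU β a i = Sum.inr (Quotient.mk β (Sum.inl i)) := by
  unfold labU
  rw [dif_neg h]

lemma labU_inl {β : PM n} {a : Fin Q → Fin n} (ha : ∀ s t, U β (a s) (a t) → s = t) {i s} :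
    labU β a i = Sum.inl s ↔ U β i (a s) := by
  constructor
  · intro h
    by_cases hh : ∃ s, U β i (a s)
    · obtain ⟨t, ht⟩ := hh
      rw [labU_pos ha ht] at h
      rw [← Sum.inl_injective h]; exact ht
    · rw [labU_neg hh] at h; cases h
  · exact labU_pos ha

lemma labU_eq {β : PM n} {a : Fin Q → Fin n} (ha : ∀ s t, U β (a s) (a t) → s = t) {i j} :
    labU β a i = labU β a j ↔ U β i j := by
  by_cases hj : ∃ s, U β j (a s)
  · obtain ⟨t, ht⟩ := hj
    rw [labU_pos ha ht, labU_inl ha]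
    exact ⟨fun h => U_trans h (U_symm ht), fun h => U_trans h ht⟩
  · rw [labU_neg hj]
    by_cases hi : ∃ s, U β i (a s)
    · obtain ⟨t, ht⟩ := hi
      rw [labU_pos ha ht]
      simp only [reduceCtorEq, false_iff]
      exact fun h => hj ⟨t, U_trans (U_symm h) ht⟩
    · rw [labU_neg hi]
      exact ⟨fun h => Quotient.exact (Sum.inr_injective h),
        fun h => congrArg Sum.inr (Quotient.sound h)⟩

/-- from the standard elements to arbitrary elements of the same rank -/
lemma up {f : Fin n → Fin Q} (hf : Function.Surjective f) {β : PM n} {a b : Fin Q → Fin n}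
    {π : Equiv.Perm (Fin Q)} (hr : rnk β ≤ Q)
    (ha : ∀ s t, U β (a s) (a t) → s = t) (hb : ∀ s t, L β (b s) (b t) → s = t)
    (hT : ∀ s, T β (a s) (b (π s))) :
    mul0 (mul0 (some (mk (labU β a) (fun i => Sum.inl (f i)))) (some (eps f π)))
      (some (mk (fun i => Sum.inl (f i)) (labU (fl β) b))) = some β := by
  have hb' : ∀ s t, U (fl β) (b s) (b t) → s = t := hb
  refine two' ?_ ?_ ?_ ?_ ?_ ?_ ?_ ?_
  · intro i j h; rw [U_eps.1 h]
  · intro i j h; rw [L_eps.1 h]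
  · intro k j k' j' h h'
    rw [T_eps] at h h'
    simp [← h, ← h']
  · intro k
    exact Or.inl ⟨a (f k), labU_pos ha (U_refl _ _)⟩
  · intro j
    exact Or.inl ⟨b (f j), labU_pos hb' (U_refl _ _)⟩
  · intro i i'; rw [labU_eq ha]
  · intro i j'
    constructor
    · intro h
      obtain ⟨s, hs⟩ := rnk_complete hr ha (fun s => ⟨_, hT s⟩) ⟨_, h⟩
      obtain ⟨k, hk⟩ := hf s
      obtain ⟨j, hj⟩ := hf (π s)
      refine ⟨k, j, ?_, ?_, ?_⟩
      · rw [labU_pos ha hs, hk]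
      · rw [T_eps, hk, hj]
      · rw [hj]
        symm
        apply labU_pos hb'
        exact T_T_L h (U_T hs (hT s))
    · rintro ⟨k, j, h1, h2, h3⟩
      rw [labU_inl ha] at h1
      have h3 := h3.symm
      rw [labU_inl hb'] at h3
      rw [T_eps] at h2
      have := hT (f k)
      rw [h2] at this
      exact T_L (U_T h1 this) (L_symm h3)
  · intro i i'; rw [labU_eq hb', U_fl]

lemma exists_surj (hQ : Q ≤ n) (h0 : 1 ≤ Q) : ∃ f : Fin n → Fin Q, Function.Surjective f := by
  obtain ⟨m, rfl⟩ : ∃ m, Q = m + 1 := ⟨Q - 1, by omega⟩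
  refine ⟨fun i => ⟨min i.1 m, by omega⟩, fun s => ⟨⟨s.1, by omega⟩, ?_⟩⟩
  ext
  simp
  omega

/-- extension of a family of transversals to colorings; all pairs in the same H-class -/
lemma exists_colors (h0 : 1 ≤ Q) {α : PM n} {a : Fin Q → Fin n}
    (ha : ∀ s t, U α (a s) (a t) → s = t) :
    ∃ c : Fin n → Fin Q, (∀ i j, U α i j → c i = c j) ∧ ∀ s, c (a s) = s := by
  refine ⟨fun i => Sum.elim id (fun _ => ⟨0, h0⟩) (labU α a i), ?_, ?_⟩
  · intro i j h
    simp only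
    rw [(labU_eq ha).2 h]
  · intro s
    simp only
    rw [labU_pos ha (U_refl _ _)]; rfl

end eps

lemma exists_colorsL {Q : ℕ} (h0 : 1 ≤ Q) {α : PM n} {c : Fin n → Fin Q}
    (hc : ∀ i j, U α i j → c i = c j) :
    ∃ d : Fin n → Fin Q, (∀ i j, L α i j → d i = d j) ∧ ∀ k j, T α k j → d j = c k := by
  classical
  let d : Fin n → Fin Q := fun j => if h : ∃ k, T α k j then c h.choose else ⟨0, h0⟩
  have hd : ∀ k j, T α k j → d j = c k := by
    intro k j h
    have hh : ∃ k, T α k j := ⟨k, h⟩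
    simp only [d, dif_pos hh]
    exact hc _ _ (T_T_U hh.choose_spec h)
  refine ⟨d, ?_, hd⟩
  intro i j h
  by_cases hi : ∃ k, T α k i
  · obtain ⟨k, hk⟩ := hi
    rw [hd _ _ hk, hd _ _ (T_L hk h)]
  · have hj : ¬ ∃ k, T α k j := fun ⟨k, hk⟩ => hi ⟨k, T_L hk (L_symm h)⟩
    simp only [d, dif_neg hi, dif_neg hj]

lemma fam_L {Q : ℕ} {β : PM n} {a b : Fin Q → Fin n} {π : Equiv.Perm (Fin Q)}
    (ha : ∀ s t, U β (a s) (a t) → s = t) (hT : ∀ s, T β (a s) (b (π s))) (s t)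
    (h : L β (b s) (b t)) : s = t := by
  have h1 := hT (π.symm s)
  have h2 := hT (π.symm t)
  simp only [Equiv.apply_symm_apply] at h1 h2
  exact π.symm.injective (ha _ _ (T_T_U (T_L h1 h) h2))

/-- elements of smaller rank are multiples -/
lemma Jle (hn : 1 ≤ n) {P : Option (PM n) → Prop} (hP : ∀ a x b, P x → P (mul0 (mul0 a x) b))
    {α β : PM n} (h : rnk β ≤ rnk α) (hPα : P (some α)) : P (some β) := by
  obtain ⟨Q, hQ⟩ : ∃ Q, Q = rnk β := ⟨_, rfl⟩
  by_cases h0 : 1 ≤ Q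
  · obtain ⟨f, hf⟩ := exists_surj (n := n) (hQ ▸ rnk_le β) h0
    obtain ⟨a, b, ha, hb⟩ := rnk_ge.1 (hQ ▸ h : Q ≤ rnk α)
    obtain ⟨c, hc, hca⟩ := exists_colors h0 ha
    obtain ⟨d, hd, hdc⟩ := exists_colorsL h0 hc
    have h1 := down hf (π := 1) hc hd (fun k j h => by simpa using hdc k j h)
      (fun s => ⟨a s, b s, hb s, hca s⟩)
    obtain ⟨a', b', ha', hb'⟩ := rnk_ge.1 hQ.le
    have h2 := up hf (π := 1) hQ.symm.le ha' (fam_L (π := 1) ha' (by simpa using hb'))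
      (by simpa using hb')
    rw [← h2]
    apply hP
    rw [← h1]
    exact hP _ _ _ hPα
  · have hβ : ∀ i j, ¬ T β i j := fun i j hT => h0 (hQ ▸ rnk_pos.2 ⟨i, j, hT⟩)
    let i0 : Fin n := ⟨0, hn⟩
    by_cases hα : ∃ i j, T α i j
    · obtain ⟨i, j, hij⟩ := hα
      have key : mul0 (mul0 (some (mk (fun i => some (Quotient.mk β (Sum.inl i))) (fun _ => none)))
        (some α)) (some (mk (fun _ => Quotient.mk β (Sum.inr i0))
        (fun i => Quotient.mk β (Sum.inr i)))) = some β := by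
        refine two' (by simp) (by simp) (by simp) ?_ ?_ ?_ ?_ ?_
        · intro k; exact Or.inr ⟨i, rfl, j, hij⟩
        · intro k; exact Or.inl ⟨i0, rfl⟩
        · intro i i'
          rw [Option.some_inj]
          exact Quotient.eq.symm
        · intro i j; simp [hβ]
        · intro i i'; exact Quotient.eq.symm
      rw [← key]
      exact hP _ _ _ hPα
    · push Not at hα
      have key : mul0 (mul0 (some (mk (fun i => (Quotient.mk β (Sum.inl i))) (fun _ => Quotient.mk β (Sum.inl i0))))
        (some α)) (some (mk (fun _ => Quotient.mk β (Sum.inr i0))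
        (fun i => Quotient.mk β (Sum.inr i)))) = some β := by
        refine two' (by simp) (by simp) (by simp) ?_ ?_ ?_ ?_ ?_
        · intro k; exact Or.inl ⟨i0, rfl⟩
        · intro k; exact Or.inl ⟨i0, rfl⟩
        · intro i i'; exact Quotient.eq.symm
        · intro i j; simp [hβ, hα]
        · intro i i'; exact Quotient.eq.symm
      rw [← key]
      exact hP _ _ _ hPα

lemma T_rank1 {α : PM n} (h : rnk α ≤ 1) {i j} : T α i j ↔ Dm α i ∧ Cd α j := by
  constructor
  · intro h; exact ⟨⟨_, h⟩, ⟨_, h⟩⟩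
  · rintro ⟨hi, k, hk⟩
    exact U_T (rnk_one h hi ⟨_, hk⟩) hk

lemma Dm_U {α : PM n} {i j} (h : U α i j) (hi : Dm α i) : Dm α j := by
  obtain ⟨k, hk⟩ := hi
  exact ⟨k, U_T (U_symm h) hk⟩

lemma Cd_L {α : PM n} {i j} (h : L α i j) (hi : Cd α i) : Cd α j := by
  obtain ⟨k, hk⟩ := hi
  exact ⟨k, T_L hk h⟩

/-- a pair of rank one elements with different domains generates all pairs of `μ↓` -/
lemma claimG {σ : Option (PM n) → Option (PM n) → Prop} (hσ : IsCongruence mul0 σ)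
    {α α' : PM n} (hU : ∀ i j, U α i j ↔ U α' i j) (r : rnk α = 1) (r' : rnk α' = 1)
    (hdis : ∀ i, Dm α i → ¬ Dm α' i) (hrel : σ (some α) (some α'))
    {β β' : PM n} (s : rnk β = 1) (s' : rnk β' = 1) (hh : hat β = hat β')
    (hC : ∀ j, Cd β j ↔ Cd β' j) : σ (some β) (some β') := by
  classical
  rw [hat_iff] at hh
  obtain ⟨hU', hL'⟩ := hh
  by_cases hd : ∃ i, Dm β i ∧ Dm β' i
  · obtain ⟨i, hi, hi'⟩ := hd
    have hD : ∀ k, Dm β k ↔ Dm β' k := by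
      intro k
      constructor
      · intro hk
        exact Dm_U ((hU' _ _).1 (rnk_one s.le hi hk)) hi'
      · intro hk
        exact Dm_U ((hU' _ _).2 (rnk_one s'.le hi' hk)) hi
    have : β = β' := PM_ext hU' hL' (fun i j => by rw [T_rank1 s.le, T_rank1 s'.le, hD, hC])
    rw [this]; exact hσ.1.refl _
  · push Not at hd
    let l : Fin n → Bool ⊕ Quotient β := fun k => Sum.inl (decide (Dm α k))
    let u : Fin n → Bool ⊕ Quotient β := fun i => if Dm β i then Sum.inl true else
      if Dm β' i then Sum.inl false else Sum.inr (Quotient.mk β (Sum.inl i))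
    let v : Fin n → Unit ⊕ Quotient β := fun _ => Sum.inl ()
    let w : Fin n → Unit ⊕ Quotient β := fun j => if Cd β j then Sum.inl () else
      Sum.inr (Quotient.mk β (Sum.inr j))
    obtain ⟨i0, j0, hT0⟩ := rnk_pos.1 s.ge
    obtain ⟨i1, j1, hT1⟩ := rnk_pos.1 s'.ge
    have hu1 : ∀ i, u i = Sum.inl true ↔ Dm β i := by
      intro i; simp only [u]; split_ifs <;> simp_all
    have hu2 : ∀ i, u i = Sum.inl false ↔ Dm β' i := by
      intro i; simp only [u]; split_ifs with h1 h2
      · simp [hd i h1]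
      · simp [h2]
      · simp [h2]
    have hw1 : ∀ j, Sum.inl () = w j ↔ Cd β j := by
      intro i; simp only [w]; split_ifs <;> simp_all
    have hl : ∀ i j, U α i j → l i = l j := by
      intro i j h
      have : Dm α i ↔ Dm α j := ⟨Dm_U h, Dm_U (U_symm h)⟩
      simp [l, this]
    have gU : ∀ i i', U β i i' ↔ u i = u i' := by
      intro i i'
      by_cases h1 : Dm β i'
      · rw [(hu1 i').2 h1, hu1]
        exact ⟨fun h => Dm_U (U_symm h) h1, fun h => rnk_one s.le h h1⟩
      by_cases h2 : Dm β' i'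
      · rw [(hu2 i').2 h2, hu2, hU']
        exact ⟨fun h => Dm_U (U_symm h) h2, fun h => rnk_one s'.le h h2⟩
      have h3 : u i' = Sum.inr (Quotient.mk β (Sum.inl i')) := by simp [u, h1, h2]
      rw [h3]
      constructor
      · intro h
        have h1' : ¬ Dm β i := fun h' => h1 (Dm_U h h')
        have h2' : ¬ Dm β' i := fun h' => h2 (Dm_U ((hU' _ _).1 h) h')
        simp only [u, h1', h2', if_false]
        exact congrArg Sum.inr (Quotient.sound h)
      · intro h
        simp only [u] at h
        split_ifs at h
        exact Quotient.exact (Sum.inr_injective h)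
    have gL : ∀ i i', L β i i' ↔ w i = w i' := by
      intro i i'
      by_cases h1 : Cd β i'
      · rw [← (hw1 i').2 h1, eq_comm, hw1]
        refine ⟨fun h => Cd_L (L_symm h) h1, fun h => ?_⟩
        exact T_T_L ((T_rank1 s.le).2 ⟨⟨_, hT0⟩, h⟩) ((T_rank1 s.le).2 ⟨⟨_, hT0⟩, h1⟩)
      have h3 : w i' = Sum.inr (Quotient.mk β (Sum.inr i')) := by simp [w, h1]
      rw [h3]
      constructor
      · intro h
        have h1' : ¬ Cd β i := fun h' => h1 (Cd_L h h')
        simp only [w, h1', if_false]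
        exact congrArg Sum.inr (Quotient.sound h)
      · intro h
        simp only [w] at h
        split_ifs at h
        exact Quotient.exact (Sum.inr_injective h)
    have h1 : ∀ k, (∃ i, u i = l k) := by
      intro k
      by_cases hk : Dm α k
      · exact ⟨i0, by rw [(hu1 i0).2 ⟨_, hT0⟩]; simp [l, hk]⟩
      · exact ⟨i1, by rw [(hu2 i1).2 ⟨_, hT1⟩]; simp [l, hk]⟩
    have h2 : ∀ j, (∃ j', w j' = v j) := fun j => ⟨j0, ((hw1 j0).2 ⟨_, hT0⟩).symm⟩
    have e1 : mul0 (mul0 (some (mk u l)) (some α)) (some (mk v w)) = some β := by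
      refine two' hl (fun _ _ _ => rfl) ?_ (fun k => Or.inl (h1 k)) (fun k => Or.inl (h2 k))
        gU ?_ gL
      · intro k j k' j' h h'
        have a1 : Dm α k := ⟨_, h⟩
        have a2 : Dm α k' := ⟨_, h'⟩
        simp [l, v, a1, a2]
      · intro i j
        rw [T_rank1 s.le, ← hu1, ← hw1]
        constructor
        · rintro ⟨ha, hb⟩
          obtain ⟨x, y, hxy⟩ := rnk_pos.1 r.ge
          have : Dm α x := ⟨_, hxy⟩
          exact ⟨x, y, by rw [ha]; simp [l, this], hxy, hb⟩
        · rintro ⟨k, j', ha, hb, hc⟩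
          have : Dm α k := ⟨_, hb⟩
          exact ⟨by rw [ha]; simp [l, this], hc⟩
    have e2 : mul0 (mul0 (some (mk u l)) (some α')) (some (mk v w)) = some β' := by
      refine two' (fun i j h => hl i j ((hU i j).2 h)) (fun _ _ _ => rfl) ?_
        (fun k => Or.inl (h1 k)) (fun k => Or.inl (h2 k))
        (fun i j => by rw [← hU', gU]) ?_ (fun i j => by rw [← hL', gL])
      · intro k j k' j' h h'
        have a1 : ¬ Dm α k := fun h'' => hdis k h'' ⟨_, h⟩
        have a2 : ¬ Dm α k' := fun h'' => hdis k' h'' ⟨_, h'⟩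
        simp [l, v, a1, a2]
      · intro i j
        rw [T_rank1 s'.le, ← hu2, ← hC, ← hw1]
        constructor
        · rintro ⟨ha, hb⟩
          obtain ⟨x, y, hxy⟩ := rnk_pos.1 r'.ge
          have : ¬ Dm α x := fun h'' => hdis x h'' ⟨_, hxy⟩
          exact ⟨x, y, by rw [ha]; simp [l, this], hxy, hb⟩
        · rintro ⟨k, j', ha, hb, hc⟩
          have : ¬ Dm α k := fun h'' => hdis k h'' ⟨_, hb⟩
          exact ⟨by rw [ha]; simp [l, this], hc⟩
    rw [← e1, ← e2]
    exact (hσ.2 _ _ _ (hσ.2 _ _ _ hrel).1).2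



/-- Rees congruence plus a relation on the rest -/
def SS (q : ℕ) (r : PM n → PM n → Prop) (a b : Option (PM n)) : Prop := ReesQ q a b ∨ lift2 r a b

def LeftOK (q : ℕ) (r : PM n → PM n → Prop) : Prop :=
  ∀ γ α β : PM n, r α β → SS q r (mul0 (some γ) (some α)) (mul0 (some γ) (some β))

def RightOK (q : ℕ) (r : PM n → PM n → Prop) : Prop :=
  ∀ γ α β : PM n, r α β → SS q r (mul0 (some α) (some γ)) (mul0 (some β) (some γ))

lemma rnkLE_none (q : ℕ) : rnkLE (none : Option (PM n)) q := fun _ h => by cases h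
lemma rnkLE_some {q : ℕ} {α : PM n} : rnkLE (some α) q ↔ rnk α ≤ q :=
  ⟨fun h => h α rfl, fun h β hβ => by cases hβ; exact h⟩

lemma rnkLE_fl {q : ℕ} {a : Option (PM n)} : rnkLE (a.map fl) q ↔ rnkLE a q := by
  cases a
  · simp [rnkLE_none]
  · simp [rnkLE_some, rnk_fl]

lemma map_fl_inj {a b : Option (PM n)} : a.map fl = b.map fl ↔ a = b :=
  ⟨fun h => by rw [← map_fl_fl a, h, map_fl_fl], fun h => by rw [h]⟩

lemma SS_fl {q : ℕ} {r : PM n → PM n → Prop} {a b} (h : SS q (fun α β => r (fl α) (fl β)) a b) :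
    SS q r (a.map fl) (b.map fl) := by
  rcases h with h | ⟨α, β, rfl, rfl, h⟩
  · left
    rcases h with rfl | ⟨h1, h2⟩
    · left; rfl
    · right; exact ⟨rnkLE_fl.2 h1, rnkLE_fl.2 h2⟩
  · right; exact ⟨_, _, rfl, rfl, h⟩

lemma right_of_left {q : ℕ} {r : PM n → PM n → Prop}
    (h : LeftOK q (fun α β => r (fl α) (fl β))) : RightOK q r := by
  intro γ α β hr
  have := SS_fl (r := r) (h (fl γ) (fl α) (fl β) (by simpa only [fl_fl] using hr))
  rw [← mul0_fl, ← mul0_fl] at this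
  simpa [fl_fl] using this

lemma rnkLE_mul_left {q : ℕ} (a : Option (PM n)) {b} (h : rnkLE b q) : rnkLE (mul0 a b) q := by
  rcases a with _ | α
  · simp [rnkLE_none]
  rcases b with _ | β
  · simp [rnkLE_none]
  by_cases hp : Phi α β = 0
  · rw [mul0_some hp, rnkLE_some]
    exact (rnk_mul_right _ _).trans (rnkLE_some.1 h)
  · rw [mul0_float hp]; exact rnkLE_none _

lemma rnkLE_mul_right {q : ℕ} {a : Option (PM n)} (b) (h : rnkLE a q) : rnkLE (mul0 a b) q := by
  rcases a with _ | α
  · simp [rnkLE_none]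
  rcases b with _ | β
  · simp [rnkLE_none]
  by_cases hp : Phi α β = 0
  · rw [mul0_some hp, rnkLE_some]
    exact (rnk_mul_left _ _).trans (rnkLE_some.1 h)
  · rw [mul0_float hp]; exact rnkLE_none _

lemma cong_SS {q : ℕ} {r : PM n → PM n → Prop} (hs : ∀ α β, r α β → r β α)
    (ht : ∀ α β γ, r α β → r β γ → r α γ) (hq : ∀ α β, r α β → q < rnk α)
    (hl : LeftOK q r) (hr : RightOK q r) : IsCongruence mul0 (SS q r) := by
  have hq' : ∀ α β, r α β → q < rnk β := fun α β h => hq _ _ (hs _ _ h)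
  refine ⟨⟨fun a => Or.inl (Or.inl rfl), ?_, ?_⟩, ?_⟩
  · rintro a b (h | ⟨α, β, rfl, rfl, h⟩)
    · left
      rcases h with rfl | ⟨h1, h2⟩
      · left; rfl
      · right; exact ⟨h2, h1⟩
    · right; exact ⟨_, _, rfl, rfl, hs _ _ h⟩
  · rintro a b c (h | ⟨α, β, rfl, rfl, h⟩) (h' | ⟨α', β', h'', rfl, h'⟩)
    · left
      rcases h with rfl | ⟨h1, h2⟩
      · exact h'
      · rcases h' with rfl | ⟨h3, h4⟩
        · right; exact ⟨h1, h2⟩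
        · right; exact ⟨h1, h4⟩
    · rcases h with rfl | ⟨h1, h2⟩
      · right; exact ⟨_, _, h'', rfl, h'⟩
      · subst h''
        have := rnkLE_some.1 h2
        have := hq _ _ h'
        omega
    · rcases h' with rfl | ⟨h1, h2⟩
      · right; exact ⟨_, _, rfl, rfl, h⟩
      · have := rnkLE_some.1 h1
        have := hq' _ _ h
        omega
    · right
      cases h''
      exact ⟨_, _, rfl, rfl, ht _ _ _ h h'⟩
  · rintro x y a (h | ⟨α, β, rfl, rfl, h⟩)
    · rcases h with rfl | ⟨h1, h2⟩
      · exact ⟨Or.inl (Or.inl rfl), Or.inl (Or.inl rfl)⟩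
      · exact ⟨Or.inl (Or.inr ⟨rnkLE_mul_left _ h1, rnkLE_mul_left _ h2⟩),
          Or.inl (Or.inr ⟨rnkLE_mul_right _ h1, rnkLE_mul_right _ h2⟩)⟩
    · rcases a with _ | γ
      · simp only [mul0_none_left, mul0_none_right]
        exact ⟨Or.inl (Or.inl rfl), Or.inl (Or.inl rfl)⟩
      · exact ⟨hl _ _ _ h, hr _ _ _ h⟩

/-! ### left multiplication -/

lemma E_mono {γ α β : PM n} (h : ∀ i j, U α i j → U β i j) {k l} (hE : E γ α k l) : E γ β k l :=
  E_le (E γ β) ⟨E_refl _ _, E_symm, E_trans⟩ (fun _ _ h' => E_L h') (fun _ _ h' => E_U (h _ _ h')) hE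

lemma E_congr {γ α β : PM n} (h : ∀ i j, U α i j ↔ U β i j) {k l} : E γ α k l ↔ E γ β k l :=
  ⟨E_mono fun i j => (h i j).1, E_mono fun i j => (h i j).2⟩

lemma Dm_mul {γ α : PM n} {i} : Dm (pmul γ α) i ↔ ∃ k l, T γ i k ∧ E γ α k l ∧ Dm α l := by
  constructor
  · rintro ⟨j, hj⟩
    obtain ⟨k, l, h1, h2, h3⟩ := T_mul.1 hj
    exact ⟨k, l, h1, h2, _, h3⟩
  · rintro ⟨k, l, h1, h2, j, h3⟩
    exact ⟨j, T_mul.2 ⟨k, l, h1, h2, h3⟩⟩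

lemma U_mul_congr {γ α β : PM n} (h : ∀ i j, U α i j ↔ U β i j) {i j} :
    U (pmul γ α) i j ↔ U (pmul γ β) i j := by
  simp only [U_mul, E_congr h]

lemma Phi_congr {γ α β : PM n} (h : ∀ i j, U α i j ↔ U β i j) (hD : ∀ i, Dm α i ↔ Dm β i) :
    Phi γ α = 0 ↔ Phi γ β = 0 := by
  simp only [Phi_zero, E_congr h, hD]

lemma Dm_mul_congr {γ α β : PM n} (h : ∀ i j, U α i j ↔ U β i j) (hD : ∀ i, Dm α i ↔ Dm β i) {i} :
    Dm (pmul γ α) i ↔ Dm (pmul γ β) i := by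
  simp only [Dm_mul, E_congr h, hD]

/-- rank preserving left multiplication stays in the L-class -/
lemma mul_L {γ α : PM n} (hr : rnk (pmul γ α) = rnk α) :
    (∀ i j, L (pmul γ α) i j ↔ L α i j) ∧ ∀ j, Cd (pmul γ α) j ↔ Cd α j := by
  obtain ⟨a, b, ha, hb⟩ := rnk_ge.1 hr.ge
  have hx : ∀ s, ∃ l, T α l (b s) ∧ ∃ k, T γ (a s) k ∧ E γ α k l := by
    intro s
    obtain ⟨k, l, h1, h2, h3⟩ := T_mul.1 (hb s)
    exact ⟨l, h3, k, h1, h2⟩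
  choose x hx1 y hx2 hx3 using hx
  have key : ∀ s t, E γ α (x s) (x t) → s = t := by
    intro s t h
    exact ha _ _ (U_mul.2 (Or.inr ⟨y s, y t, hx2 s,
      E_trans (hx3 s) (E_trans h (E_symm (hx3 t))), hx2 t⟩))
  have comp : ∀ i, Dm α i → ∃ s, U α i (x s) := fun i hi =>
    rnk_complete le_rfl (fun s t h => key s t (E_U h)) (fun s => ⟨_, hx1 s⟩) hi
  constructor
  · intro i j
    rw [L_mul]
    constructor
    · rintro (h | ⟨k, l, h1, h2, h3⟩)
      · exact h
      · obtain ⟨s, hs⟩ := comp k ⟨_, h1⟩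
        obtain ⟨t, ht⟩ := comp l ⟨_, h3⟩
        have := key s t (E_trans (E_symm (E_U hs)) (E_trans h2 (E_U ht)))
        subst this
        exact T_T_L h1 (U_T (U_trans hs (U_symm ht)) h3)
    · exact Or.inl
  · intro j
    constructor
    · rintro ⟨i, hi⟩
      obtain ⟨k, l, h1, h2, h3⟩ := T_mul.1 hi
      exact ⟨_, h3⟩
    · rintro ⟨i, hi⟩
      obtain ⟨s, hs⟩ := comp i ⟨_, hi⟩
      exact ⟨a s, T_mul.2 ⟨y s, i, hx2 s, E_trans (hx3 s) (E_U (U_symm hs)), hi⟩⟩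

lemma nu_left {Q : ℕ} {N : Subgroup (Equiv.Perm (Fin Q))} {γ α β : PM n} (h : nuRel Q N α β)
    (hr : rnk (pmul γ α) = Q) : nuRel Q N (pmul γ α) (pmul γ β) := by
  obtain ⟨r1, r2, hH, a, b, π, ha, hb, hb', hπ⟩ := h
  obtain ⟨⟨hU, hD⟩, hL, hC⟩ := greenH_iff.1 hH
  have hr' : rnk (pmul γ β) = Q := by
    rw [← hr]
    exact (rnk_congr (fun i j => U_mul_congr hU) (fun i => Dm_mul_congr hU hD)).symm
  obtain ⟨l1, c1⟩ := mul_L (hr.trans r1.symm)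
  obtain ⟨l2, c2⟩ := mul_L (hr'.trans r2.symm)
  refine ⟨hr, hr', greenH_iff.2 ⟨⟨fun i j => U_mul_congr hU, fun i => Dm_mul_congr hU hD⟩,
    fun i j => by rw [l1, l2, hL], fun j => by rw [c1, c2, hC]⟩, ?_⟩
  have hi : ∀ s, ∃ i, T (pmul γ α) i (b s) := fun s => (c1 _).2 ⟨_, hb s⟩
  choose i hi using hi
  refine ⟨i, b, π, ?_, hi, ?_, hπ⟩
  · intro s t h
    have : L (pmul γ α) (b s) (b t) := T_T_L (hi s) (U_T h (hi t))
    exact ha s t (T_T_U (T_L (hb s) ((l1 _ _).1 this)) (hb t))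
  · intro s
    obtain ⟨k, l, h1, h2, h3⟩ := T_mul.1 (hi s)
    refine T_mul.2 ⟨k, a s, h1, E_trans ((E_congr hU).1 h2) (E_U ?_), hb' s⟩
    exact (hU _ _).1 (T_T_U h3 (hb s))

lemma nu_fl {Q : ℕ} {N : Subgroup (Equiv.Perm (Fin Q))} {α β : PM n} (h : nuRel Q N α β) :
    nuRel Q N (fl α) (fl β) := by
  obtain ⟨r1, r2, hH, a, b, π, ha, hb, hb', hπ⟩ := h
  obtain ⟨⟨hU, hD⟩, hL, hC⟩ := greenH_iff.1 hH
  refine ⟨by rw [rnk_fl, r1], by rw [rnk_fl, r2], greenH_iff.2 ⟨⟨hL, fun i => ?_⟩, hU, fun i => ?_⟩,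
    b, a, π⁻¹, ?_, ?_, ?_, N.inv_mem hπ⟩
  · rw [Dm_fl, Dm_fl, hC]
  · rw [Cd_fl, Cd_fl, hD]
  · intro s t h
    exact ha s t (T_T_U (T_L (hb s) h) (hb t))
  · intro s; exact T_fl.2 (hb s)
  · intro s
    apply T_fl.2
    have e : π (π⁻¹ s) = s := by simp
    have := hb' (π⁻¹ s)
    rw [e] at this
    exact this

lemma nu_fl_iff {Q : ℕ} {N : Subgroup (Equiv.Perm (Fin Q))} {α β : PM n} :
    nuRel Q N (fl α) (fl β) ↔ nuRel Q N α β :=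
  ⟨fun h => by simpa only [fl_fl] using nu_fl h, nu_fl⟩

/-- alternative description of the permutational difference -/
lemma nu_iff {Q : ℕ} {N : Subgroup (Equiv.Perm (Fin Q))} [hN : N.Normal] {α β : PM n} :
    nuRel Q N α β ↔ rnk α = Q ∧ rnk β = Q ∧ greenH pmul α β ∧
      ∀ (a b : Fin Q → Fin n), (∀ s t, U α (a s) (a t) → s = t) → (∀ s, T α (a s) (b s)) →
        ∃ π ∈ N, ∀ s, T β (a s) (b (π s)) := by
  constructor
  · rintro ⟨r1, r2, hH, a, b, π, ha, hb, hb', hπ⟩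
    refine ⟨r1, r2, hH, ?_⟩
    obtain ⟨⟨hU, hD⟩, hL, hC⟩ := greenH_iff.1 hH
    intro a' b' ha' hb''
    have comp : ∀ s, ∃ t, U α (a' s) (a t) := fun s =>
      rnk_complete r1.le ha (fun s => ⟨_, hb s⟩) ⟨_, hb'' s⟩
    choose ρ hρ using comp
    have inj : Function.Injective ρ := by
      intro s t h
      apply ha'
      have h1 := hρ s
      rw [h] at h1
      exact U_trans h1 (U_symm (hρ t))
    let ρ' : Equiv.Perm (Fin Q) := Equiv.ofBijective ρ (Finite.injective_iff_bijective.1 inj)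
    have hρ' : ∀ s, U α (a' s) (a (ρ' s)) := hρ
    refine ⟨ρ'⁻¹ * π * ρ', by simpa using hN.conj_mem π hπ ρ'⁻¹, ?_⟩
    intro s
    have h1 : T β (a' s) (b (π (ρ' s))) := U_T ((hU _ _).1 (hρ' s)) (hb' _)
    refine T_L h1 ((hL _ _).1 ?_)
    have h2 := hb'' ((ρ'⁻¹ * π * ρ') s)
    have h3 := hρ' ((ρ'⁻¹ * π * ρ') s)
    have e : ρ' ((ρ'⁻¹ * π * ρ') s) = π (ρ' s) := by simp
    rw [e] at h3
    exact T_T_L (U_T h3 (hb _)) h2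
  · rintro ⟨r1, r2, hH, h⟩
    obtain ⟨a, b, ha, hb⟩ := rnk_ge.1 r1.ge
    obtain ⟨π, hπ, hh⟩ := h a b ha hb
    exact ⟨r1, r2, hH, a, b, π, ha, hb, hh, hπ⟩

lemma nu_symm {Q : ℕ} {N : Subgroup (Equiv.Perm (Fin Q))} {α β : PM n} (h : nuRel Q N α β) :
    nuRel Q N β α := by
  obtain ⟨r1, r2, hH, a, b, π, ha, hb, hb', hπ⟩ := h
  obtain ⟨⟨hU, hD⟩, hL, hC⟩ := greenH_iff.1 hH
  refine ⟨r2, r1, ⟨hH.1.symm, hH.2.symm⟩, a, fun s => b (π s), π⁻¹, ?_, hb', ?_, N.inv_mem hπ⟩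
  · intro s t h; exact ha s t ((hU _ _).2 h)
  · intro s
    simpa using hb s

lemma nu_trans {Q : ℕ} {N : Subgroup (Equiv.Perm (Fin Q))} [hN : N.Normal] {α β γ : PM n}
    (h : nuRel Q N α β) (h' : nuRel Q N β γ) : nuRel Q N α γ := by
  obtain ⟨r1, r2, hH, a, b, π, ha, hb, hb', hπ⟩ := h
  obtain ⟨r3, r4, hH', h'⟩ := nu_iff.1 h'
  obtain ⟨⟨hU, hD⟩, hL, hC⟩ := greenH_iff.1 hH
  obtain ⟨ρ, hρ, hh⟩ := h' a (fun s => b (π s)) (fun s t h => ha s t ((hU _ _).2 h)) hb'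
  exact ⟨r1, r4, ⟨hH.1.trans hH'.1, hH.2.trans hH'.2⟩, a, b, π * ρ, ha, hb, hh,
    N.mul_mem hπ hρ⟩

lemma nu_Phi {Q : ℕ} {N : Subgroup (Equiv.Perm (Fin Q))} {α β : PM n} (h : nuRel Q N α β)
    (γ : PM n) : (Phi γ α = 0 ↔ Phi γ β = 0) ∧ rnk (pmul γ α) = rnk (pmul γ β) := by
  obtain ⟨⟨hU, hD⟩, hL, hC⟩ := greenH_iff.1 h.2.2.1
  exact ⟨Phi_congr hU hD, rnk_congr (fun i j => U_mul_congr hU) (fun i => Dm_mul_congr hU hD)⟩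

lemma cong_nu {Q : ℕ} (hQ : 1 ≤ Q) (N : Subgroup (Equiv.Perm (Fin Q))) [hN : N.Normal] :
    IsCongruence mul0 (SS (n := n) (Q - 1) (nuRel Q N)) := by
  have hl : LeftOK (n := n) (Q - 1) (nuRel Q N) := by
    intro γ α β h
    obtain ⟨h1, h2⟩ := nu_Phi h γ
    by_cases hp : Phi γ α = 0
    · rw [mul0_some hp, mul0_some (h1.1 hp)]
      have := rnk_mul_right γ α
      have := h.1
      by_cases hr : rnk (pmul γ α) = Q
      · exact Or.inr ⟨_, _, rfl, rfl, nu_left h hr⟩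
      · refine Or.inl (Or.inr ⟨rnkLE_some.2 ?_, rnkLE_some.2 ?_⟩) <;> omega
    · rw [mul0_float hp, mul0_float (fun h => hp (h1.2 h))]
      exact Or.inl (Or.inl rfl)
  refine cong_SS (fun _ _ h => nu_symm h) (fun _ _ _ h h' => nu_trans h h') ?_ hl (right_of_left ?_)
  · intro α β h; have := h.1; omega
  · simpa only [nu_fl_iff] using hl

/-! ### the relations mu -/

/-- rank one elements with the same hat -/
def muR (α β : PM n) : Prop := rnk α = 1 ∧ rnk β = 1 ∧ hat α = hat β

lemma hat_fl {α β : PM n} : hat (fl α) = hat (fl β) ↔ hat α = hat β := by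
  rw [hat_iff, hat_iff]
  simp only [U_fl, L_fl]
  exact and_comm

lemma muR_fl {α β : PM n} : muR (fl α) (fl β) ↔ muR α β := by
  unfold muR
  rw [rnk_fl, rnk_fl, hat_fl]

lemma muR_symm {α β : PM n} (h : muR α β) : muR β α := ⟨h.2.1, h.1, h.2.2.symm⟩
lemma muR_trans {α β γ : PM n} (h : muR α β) (h' : muR β γ) : muR α γ :=
  ⟨h.1, h'.2.1, h.2.2.trans h'.2.2⟩

lemma mu_left {γ α β : PM n} (h : muR α β) (hp : Phi γ α = 0) (hr : rnk (pmul γ α) = 1) :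
    Phi γ β = 0 ∧ muR (pmul γ α) (pmul γ β) ∧ (∀ j, Cd (pmul γ α) j ↔ Cd α j) ∧
      (∀ j, Cd (pmul γ β) j ↔ Cd β j) := by
  obtain ⟨r1, r2, hh⟩ := h
  obtain ⟨hU, hL⟩ := hat_iff.1 hh
  obtain ⟨i, j, hij⟩ := rnk_pos.1 hr.ge
  obtain ⟨k, l, h1, h2, h3⟩ := T_mul.1 hij
  have touch : ∀ x, ∃ y, E γ β x y ∧ Cd γ y := by
    intro x
    obtain ⟨y, hy, hy' | hy'⟩ := Phi_zero.1 hp x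
    · exact ⟨y, (E_congr hU).1 hy, hy'⟩
    · refine ⟨k, (E_congr hU).1 (E_trans hy (E_trans (E_U (rnk_one r1.le hy' ⟨_, h3⟩)) (E_symm h2))),
        ⟨_, h1⟩⟩
  have hp' : Phi γ β = 0 := Phi_zero.2 fun x => by
    obtain ⟨y, h, h'⟩ := touch x
    exact ⟨y, h, Or.inl h'⟩
  have hr' : rnk (pmul γ β) = 1 := by
    apply le_antisymm ((rnk_mul_right _ _).trans r2.le)
    obtain ⟨x, y, hxy⟩ := rnk_pos.1 r2.ge
    obtain ⟨z, hz, w, hw⟩ := touch x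
    exact rnk_pos.2 ⟨w, y, T_mul.2 ⟨z, x, hw, E_symm hz, hxy⟩⟩
  obtain ⟨l1, c1⟩ := mul_L (hr.trans r1.symm)
  obtain ⟨l2, c2⟩ := mul_L (hr'.trans r2.symm)
  exact ⟨hp', ⟨hr, hr', hat_iff.2 ⟨fun i j => U_mul_congr hU, fun i j => by rw [l1, l2, hL]⟩⟩, c1, c2⟩

lemma mu_leftOK {r : PM n → PM n → Prop} (hs : ∀ α β, r α β → r β α) (hr : ∀ α β, r α β → muR α β)
    (h : ∀ γ α β, r α β → rnk (pmul γ α) = 1 → rnk (pmul γ β) = 1 →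
      muR (pmul γ α) (pmul γ β) → (∀ j, Cd (pmul γ α) j ↔ Cd α j) →
      (∀ j, Cd (pmul γ β) j ↔ Cd β j) → r (pmul γ α) (pmul γ β)) : LeftOK 0 r := by
  have key : ∀ γ α β, r α β → ¬ (Phi γ α = 0 ∧ rnk (pmul γ α) = 1) →
      rnkLE (mul0 (some γ) (some α)) 0 := by
    intro γ α β hh hc
    by_cases hp : Phi γ α = 0
    · rw [mul0_some hp, rnkLE_some]
      have := rnk_mul_right γ α
      have := (hr _ _ hh).1
      have : ¬ rnk (pmul γ α) = 1 := fun h => hc ⟨hp, h⟩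
      omega
    · rw [mul0_float hp]; exact rnkLE_none _
  intro γ α β hh
  by_cases h1 : Phi γ α = 0 ∧ rnk (pmul γ α) = 1
  · obtain ⟨hp, hm, c1, c2⟩ := mu_left (hr _ _ hh) h1.1 h1.2
    rw [mul0_some h1.1, mul0_some hp]
    exact Or.inr ⟨_, _, rfl, rfl, h _ _ _ hh h1.2 hm.2.1 hm c1 c2⟩
  · by_cases h2 : Phi γ β = 0 ∧ rnk (pmul γ β) = 1
    · obtain ⟨hp, hm, -⟩ := mu_left (muR_symm (hr _ _ hh)) h2.1 h2.2
      exact absurd ⟨hp, hm.2.1⟩ h1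
    · exact Or.inl (Or.inr ⟨key _ _ _ hh h1, key _ _ _ (hs _ _ hh) h2⟩)

lemma greenR_fl {α β : PM n} : greenR pmul (fl α) (fl β) ↔ greenL pmul α β := greenL_fl.symm
lemma greenL_fl' {α β : PM n} : greenL pmul (fl α) (fl β) ↔ greenR pmul α β := by
  rw [greenL_fl, fl_fl, fl_fl]

lemma mu_ok : LeftOK 0 (muR (n := n)) :=
  mu_leftOK (fun _ _ => muR_symm) (fun _ _ h => h) (fun _ _ _ _ _ _ h _ _ => h)

lemma muUp_ok : LeftOK 0 (fun α β : PM n => muR α β ∧ greenR pmul α β) := by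
  refine mu_leftOK (fun _ _ h => ⟨muR_symm h.1, h.2.symm⟩) (fun _ _ h => h.1) ?_
  rintro γ α β ⟨h, h'⟩ - - hm - -
  obtain ⟨hU, hD⟩ := greenR_iff.1 h'
  exact ⟨hm, greenR_iff.2 ⟨fun i j => U_mul_congr hU, fun i => Dm_mul_congr hU hD⟩⟩

lemma muDn_ok : LeftOK 0 (fun α β : PM n => muR α β ∧ greenL pmul α β) := by
  refine mu_leftOK (fun _ _ h => ⟨muR_symm h.1, h.2.symm⟩) (fun _ _ h => h.1) ?_
  rintro γ α β ⟨h, h'⟩ - - hm c1 c2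
  obtain ⟨hL, hC⟩ := greenL_iff.1 h'
  exact ⟨hm, greenL_iff.2 ⟨(hat_iff.1 hm.2.2).2, fun i => by rw [c1, c2, hC]⟩⟩

lemma cong_mu : IsCongruence mul0 (SS 0 (muR (n := n))) := by
  refine cong_SS (fun _ _ => muR_symm) (fun _ _ _ => muR_trans) (fun _ _ h => ?_) mu_ok
    (right_of_left ?_)
  · rw [h.1]; exact one_pos
  · simpa only [muR_fl] using mu_ok

lemma cong_muUp : IsCongruence mul0 (SS 0 (fun α β : PM n => muR α β ∧ greenR pmul α β)) := by
  refine cong_SS (fun _ _ h => ⟨muR_symm h.1, h.2.symm⟩)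
    (fun _ _ _ h h' => ⟨muR_trans h.1 h'.1, h.2.trans h'.2⟩) (fun _ _ h => ?_) muUp_ok
    (right_of_left ?_)
  · rw [h.1.1]; exact one_pos
  · simpa only [muR_fl, greenR_fl] using muDn_ok

lemma cong_muDn : IsCongruence mul0 (SS 0 (fun α β : PM n => muR α β ∧ greenL pmul α β)) := by
  refine cong_SS (fun _ _ h => ⟨muR_symm h.1, h.2.symm⟩)
    (fun _ _ _ h h' => ⟨muR_trans h.1 h'.1, h.2.trans h'.2⟩) (fun _ _ h => ?_) muDn_ok
    (right_of_left ?_)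
  · rw [h.1.1]; exact one_pos
  · simpa only [muR_fl, greenL_fl'] using muUp_ok

lemma rnk_three {α : PM n} (h : rnk α ≤ 2) {i j k} (hi : Dm α i) (hj : Dm α j) (hk : Dm α k)
    (hij : ¬ U α i j) : U α k i ∨ U α k j := by
  obtain ⟨s, hs⟩ := rnk_complete (a := ![i, j]) h (by
    intro s t
    fin_cases s <;> fin_cases t <;> simp
    · exact hij
    · exact fun h' => hij (U_symm h')) (by intro s; fin_cases s <;> simpa) hk
  fin_cases s
  · exact Or.inl hs
  · exact Or.inr hs

lemma hat_mul_two {N : Subgroup (Equiv.Perm (Fin 2))} {γ α β : PM n} (h : nuRel 2 N α β) :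
    hat (pmul γ α) = hat (pmul γ β) := by
  have key : ∀ {α β : PM n}, nuRel 2 N α β → ∀ i j, L (pmul γ α) i j → L (pmul γ β) i j := by
    intro α β h i j hij
    obtain ⟨⟨hU, hD⟩, hL, hC⟩ := greenH_iff.1 h.2.2.1
    by_cases hb : L α i j
    · exact L_mul.2 (Or.inl ((hL _ _).1 hb))
    rcases L_mul.1 hij with h' | ⟨k, l, h1, h2, h3⟩
    · exact absurd h' hb
    obtain ⟨k', hk'⟩ := (hC i).1 ⟨_, h1⟩
    obtain ⟨l', hl'⟩ := (hC j).1 ⟨_, h3⟩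
    have n1 : ¬ U α k l := fun hh => hb (T_T_L h1 (U_T hh h3))
    have a1 := rnk_three h.1.le ⟨_, h1⟩ ⟨_, h3⟩ ((hD k').2 ⟨_, hk'⟩) n1
    have a2 := rnk_three h.1.le ⟨_, h1⟩ ⟨_, h3⟩ ((hD l').2 ⟨_, hl'⟩) n1
    have b : ∀ x, U α x k ∨ U α x l → E γ β x k := by
      rintro x (hx | hx)
      · exact E_U ((hU _ _).1 hx)
      · exact E_trans (E_U ((hU _ _).1 hx)) (E_symm ((E_congr hU).1 h2))
    exact L_mul.2 (Or.inr ⟨k', l', hk', E_trans (b _ a1) (E_symm (b _ a2)), hl'⟩)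
  obtain ⟨⟨hU, hD⟩, hL, hC⟩ := greenH_iff.1 h.2.2.1
  exact hat_iff.2 ⟨fun i j => U_mul_congr hU, fun i j => ⟨key h i j, key (nu_symm h) i j⟩⟩

lemma muS2_ok : LeftOK (n := n) 0 (fun α β => muR α β ∨ nuRel 2 ⊤ α β) := by
  rintro γ α β (h | h)
  · rcases mu_ok γ α β h with h | ⟨α', β', h1, h2, h⟩
    · exact Or.inl h
    · exact Or.inr ⟨α', β', h1, h2, Or.inl h⟩
  · obtain ⟨h1, h2⟩ := nu_Phi h γ
    by_cases hp : Phi γ α = 0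
    · rw [mul0_some hp, mul0_some (h1.1 hp)]
      have := rnk_mul_right γ α
      have := h.1
      by_cases hr : rnk (pmul γ α) = 2
      · exact Or.inr ⟨_, _, rfl, rfl, Or.inr (nu_left h hr)⟩
      by_cases hr : rnk (pmul γ α) = 1
      · exact Or.inr ⟨_, _, rfl, rfl, Or.inl ⟨hr, by omega, hat_mul_two h⟩⟩
      · refine Or.inl (Or.inr ⟨rnkLE_some.2 ?_, rnkLE_some.2 ?_⟩) <;> omega
    · rw [mul0_float hp, mul0_float (fun h => hp (h1.2 h))]
      exact Or.inl (Or.inl rfl)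

lemma cong_muS2 : IsCongruence mul0 (SS (n := n) 0 (fun α β => muR α β ∨ nuRel 2 ⊤ α β)) := by
  have : (⊤ : Subgroup (Equiv.Perm (Fin 2))).Normal := inferInstance
  refine cong_SS ?_ ?_ ?_ muS2_ok (right_of_left ?_)
  · rintro α β (h | h)
    · exact Or.inl (muR_symm h)
    · exact Or.inr (nu_symm h)
  · rintro α β γ (h | h) (h' | h')
    · exact Or.inl (muR_trans h h')
    · have := h.2.1; have := h'.1; omega
    · have := h.2.1; have := h'.1; omega
    · exact Or.inr (nu_trans h h')
  · rintro α β (h | h)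
    · have := h.1; omega
    · have := h.1; omega
  · simpa only [muR_fl, nu_fl_iff] using muS2_ok

lemma cong_Rees (q : ℕ) : IsCongruence mul0 (ReesQ (n := n) q) := by
  have : (ReesQ (n := n) q) = SS q (fun _ _ => False) := by
    funext a b
    apply propext
    simp [SS, lift2]
  rw [this]
  exact cong_SS (fun _ _ h => h) (fun _ _ _ h _ => h) (fun _ _ h => h.elim)
    (fun _ _ _ h => h.elim) (fun _ _ _ h => h.elim)

lemma cong_eq : IsCongruence mul0 (fun a b : Option (PM n) => a = b) :=
  ⟨⟨fun _ => rfl, fun h => h.symm, fun h h' => h.trans h'⟩, fun x y a h => by subst h; exact ⟨rfl, rfl⟩⟩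



/-! ### test multipliers -/

/-- two upper blocks `X`, `Xᶜ`, with `Xᶜ` transversal and `X` not -/
noncomputable def gX (X : Fin n → Prop) : PM n := open Classical in
  mk (fun i => if X i then (0 : Fin 3) else 2) (fun i => if X i then (1 : Fin 3) else 2)

lemma U_gX {X : Fin n → Prop} {i j} : U (gX X) i j ↔ (X i ↔ X j) := by
  unfold gX; rw [U_mk]; by_cases h : X i <;> by_cases h' : X j <;> simp [h, h']
lemma L_gX {X : Fin n → Prop} {i j} : L (gX X) i j ↔ (X i ↔ X j) := by
  unfold gX; rw [L_mk]; by_cases h : X i <;> by_cases h' : X j <;> simp [h, h']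
lemma T_gX {X : Fin n → Prop} {i j} : T (gX X) i j ↔ (¬ X i ∧ ¬ X j) := by
  unfold gX; rw [T_mk]; by_cases h : X i <;> by_cases h' : X j <;> simp [h, h']

def IsoW (α : PM n) (X : Fin n → Prop) : Prop :=
  (∀ i j, X i → U α i j → X j) ∧ ∀ i, X i → ¬ Dm α i

def Iso (α : PM n) (X : Fin n → Prop) : Prop := (∃ i, X i) ∧ IsoW α X

lemma gX_E {X : Fin n → Prop} {α : PM n} (h : ∀ i j, X i → U α i j → X j) {i j}
    (hE : E (gX X) α i j) : X i ↔ X j := by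
  have := E_map (C := Prop) X (γ := gX X) (α := α) (fun k l h => propext (L_gX.1 h))
    (fun k l h' => propext ⟨fun hk => h _ _ hk h', fun hl => h _ _ hl (U_symm h')⟩) hE
  rw [this]

lemma gX_none {X : Fin n → Prop} {α : PM n} :
    mul0 (some (gX X)) (some α) = none ↔ Iso α X := by
  have : mul0 (some (gX X)) (some α) = none ↔ ¬ Phi (gX X) α = 0 := by
    by_cases h : Phi (gX X) α = 0
    · rw [mul0_some h]; simp [h]
    · rw [mul0_float h]; simp [h]
  rw [this, Phi_zero]
  constructor
  · intro h
    push Not at h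
    obtain ⟨k, hk⟩ := h
    have hX : ∀ l, E (gX X) α k l → X l := by
      intro l hl
      by_contra hc
      exact (hk l hl).1 ⟨l, T_gX.2 ⟨hc, hc⟩⟩
    have hkX := hX k (E_refl _ _ _)
    have hE : ∀ l, X l → E (gX X) α k l := fun l hl => E_L (L_gX.2 ⟨fun _ => hl, fun _ => hkX⟩)
    exact ⟨⟨k, hkX⟩, fun i j hi hij => hX _ (E_trans (hE i hi) (E_U hij)), fun i hi => (hk i (hE i hi)).2⟩
  · rintro ⟨⟨k, hk⟩, h1, h2⟩ h
    obtain ⟨l, hl, hl'⟩ := h k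
    have hXl := (gX_E h1 hl).1 hk
    rcases hl' with ⟨x, hx⟩ | hl'
    · exact (T_gX.1 hx).2 hXl
    · exact h2 _ hXl hl'

lemma gX_rank0 {X : Fin n → Prop} {α : PM n} (hα : 1 ≤ rnk α) :
    rnk (pmul (gX X) α) = 0 ↔ IsoW α (fun i => ¬ X i) := by
  have : rnk (pmul (gX X) α) = 0 ↔ ¬ ∃ i j, T (pmul (gX X) α) i j := by
    rw [← rnk_pos]; omega
  rw [this]
  constructor
  · intro h
    have h' : ∀ k l, ¬ X k → E (gX X) α k l → ¬ Dm α l := by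
      rintro k l hk hE ⟨j, hj⟩
      exact h ⟨k, j, T_mul.2 ⟨k, l, T_gX.2 ⟨hk, hk⟩, hE, hj⟩⟩
    refine ⟨fun i j hi hij hj => ?_, fun i hi => h' i i hi (E_refl _ _ _)⟩
    obtain ⟨x, y, hxy⟩ := rnk_pos.1 hα
    have : E (gX X) α i x := by
      by_cases hx : X x
      · exact E_trans (E_U hij) (E_L (L_gX.2 ⟨fun _ => hx, fun _ => hj⟩))
      · exact E_L (L_gX.2 ⟨fun h => absurd h hi, fun h => absurd h hx⟩)
    exact h' i x hi this ⟨_, hxy⟩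
  · rintro ⟨h1, h2⟩ ⟨i, j, hij⟩
    obtain ⟨k, l, hk, hE, hl⟩ := T_mul.1 hij
    have := (gX_E (X := X) (fun i j hi hij => by
      by_contra hj
      exact h1 j i hj (U_symm hij) hi) hE)
    have hXl : ¬ X l := fun h => (T_gX.1 hk).2 (this.2 h)
    exact h2 l hXl ⟨_, hl⟩

/-- after multiplying by `gX A`, `A` a transversal block of `α`, the lower part is isolated -/
lemma gA_iso {α : PM n} {i j : Fin n} (hij : T α i j) :
    Iso (fl (pmul (gX (U α i)) α)) (L α j) := by
  have hcl : ∀ k l, U α i k → U α k l → U α i l := fun k l h h' => U_trans h h'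
  refine ⟨⟨j, L_refl _ _⟩, ?_, ?_⟩
  · intro l m hl hlm
    rw [U_fl] at hlm
    rcases L_mul.1 hlm with h | ⟨k, k', h1, h2, h3⟩
    · exact L_trans hl h
    · have hik : U α i k := T_T_U (T_L hij hl) h1
      have hik' : U α i k' := (gX_E hcl h2).1 hik
      exact T_T_L hij (U_T hik' h3)
  · intro l hl hd
    rw [Dm_fl] at hd
    obtain ⟨x, hx⟩ := hd
    obtain ⟨k, k', h1, h2, h3⟩ := T_mul.1 hx
    have hik' : U α i k' := T_T_U (T_L hij hl) h3
    exact (T_gX.1 h1).2 ((gX_E hcl h2).2 hik')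

section main
variable {σ : Option (PM n) → Option (PM n) → Prop}

lemma mulL (hσ : IsCongruence mul0 σ) (γ : PM n) {α β : PM n} (h : σ (some α) (some β)) :
    σ (mul0 (some γ) (some α)) (mul0 (some γ) (some β)) := (hσ.2 _ _ _ h).1
lemma mulR (hσ : IsCongruence mul0 σ) (γ : PM n) {α β : PM n} (h : σ (some α) (some β)) :
    σ (mul0 (some α) (some γ)) (mul0 (some β) (some γ)) := (hσ.2 _ _ _ h).2

lemma dual_some {α β : PM n} (h : σ (some α) (some β)) : dual σ (some (fl α)) (some (fl β)) := by
  unfold dual; simpa [fl_fl] using h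

lemma dual_some' {α β : PM n} (h : dual σ (some α) (some β)) : σ (some (fl α)) (some (fl β)) := h

/-! ### no nonzero elements in the ideal class -/

def Z0 (σ : Option (PM n) → Option (PM n) → Prop) : Prop := ∀ a, σ none a → a = none

lemma Z0_dual (hZ : Z0 σ) : Z0 (dual σ) := by
  intro a h
  have := hZ _ h
  cases a
  · rfl
  · cases this

lemma Z0_iff (hσ : IsCongruence mul0 σ) (hZ : Z0 σ) {a b} (h : σ a b) : a = none ↔ b = none :=
  ⟨fun h' => hZ _ (h' ▸ h), fun h' => hZ _ (hσ.1.symm (h' ▸ h))⟩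

lemma Z0_iso (hσ : IsCongruence mul0 σ) (hZ : Z0 σ) {α β} (h : σ (some α) (some β)) (X) :
    Iso α X ↔ Iso β X := by
  rw [← gX_none, ← gX_none]
  exact Z0_iff hσ hZ (mulL hσ _ h)

lemma Iso_class {α : PM n} {i} (h : ¬ Dm α i) : Iso α (U α i) :=
  ⟨⟨i, U_refl _ _⟩, fun _ _ h1 h2 => U_trans h1 h2, fun _ h1 h2 => h (Dm_U (U_symm h1) h2)⟩

lemma Z0_nDm (hσ : IsCongruence mul0 σ) (hZ : Z0 σ) {α β} (h : σ (some α) (some β)) {i}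
    (hi : ¬ Dm α i) : ¬ Dm β i ∧ ∀ j, U β i j → U α i j := by
  have := (Z0_iso hσ hZ h _).1 (Iso_class hi)
  exact ⟨this.2.2 i (U_refl _ _), fun j hj => this.2.1 i j (U_refl _ _) hj⟩

lemma Z0_Dm (hσ : IsCongruence mul0 σ) (hZ : Z0 σ) {α β} (h : σ (some α) (some β)) {i}
    (hi : Dm α i) : Dm β i := by
  by_contra hc
  exact (Z0_nDm hσ hZ (hσ.1.symm h) hc).1 hi

lemma Z0_T1 (hσ : IsCongruence mul0 σ) (hZ : Z0 σ) {α β} (h : σ (some α) (some β)) {i j k}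
    (hij : T α i j) (hkj : T β k j) : U α i k := by
  by_contra hc
  have h1 : ¬ Phi (gX (U α i)) α ≠ 0 := fun hp => by
    exact (gX_none.1 (mul0_float hp)).2.2 i (U_refl _ _) ⟨_, hij⟩
  have h2 : ¬ Phi (gX (U α i)) β ≠ 0 := fun hp => by
    exact ((Z0_iso hσ hZ h _).2 (gX_none.1 (mul0_float hp))).2.2 i (U_refl _ _) ⟨_, hij⟩
  push Not at h1 h2
  have hr := mulL hσ (gX (U α i)) h
  rw [mul0_some h1, mul0_some h2] at hr
  have := (Z0_iso (dual_cong hσ) (Z0_dual hZ) (dual_some hr) _).1 (gA_iso hij)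
  refine this.2.2 j (L_refl _ _) (Dm_fl.2 ⟨k, T_mul.2 ⟨k, k, T_gX.2 ⟨hc, hc⟩, E_refl _ _ _, hkj⟩⟩)

lemma Z0_T (hσ : IsCongruence mul0 σ) (hZ : Z0 σ) {α β} (h : σ (some α) (some β)) {i j}
    (hij : T α i j) : T β i j := by
  have : Dm (fl β) j := Z0_Dm (dual_cong hσ) (Z0_dual hZ) (dual_some h) (Dm_fl.2 ⟨_, hij⟩)
  obtain ⟨k, hk⟩ := Dm_fl.1 this
  exact U_T (U_symm (Z0_T1 hσ hZ (hσ.1.symm h) hk hij)) hk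

lemma Z0_U (hσ : IsCongruence mul0 σ) (hZ : Z0 σ) {α β} (h : σ (some α) (some β)) {i j}
    (hij : U α i j) : U β i j := by
  by_cases hi : Dm α i
  · obtain ⟨k, hk⟩ := hi
    exact T_T_U (Z0_T hσ hZ h hk) (Z0_T hσ hZ h (U_T (U_symm hij) hk))
  · exact (Z0_nDm hσ hZ (hσ.1.symm h) (Z0_nDm hσ hZ h hi).1).2 j hij

lemma Z0_eq (hσ : IsCongruence mul0 σ) (hZ : Z0 σ) : σ = (· = ·) := by
  funext a b
  apply propext
  constructor
  · intro h
    rcases a with _ | α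
    · exact (hZ _ h).symm
    rcases b with _ | β
    · exact hZ _ (hσ.1.symm h)
    have h' := hσ.1.symm h
    have hd := dual_some h
    have hd' := dual_some h'
    have hσ' := dual_cong hσ
    have hZ' := Z0_dual hZ
    congr 1
    exact PM_ext (fun i j => ⟨Z0_U hσ hZ h, Z0_U hσ hZ h'⟩)
      (fun i j => ⟨fun hh => Z0_U hσ' hZ' hd hh, fun hh => Z0_U hσ' hZ' hd' hh⟩)
      (fun i j => ⟨Z0_T hσ hZ h, Z0_T hσ hZ h'⟩)
  · rintro rfl; exact hσ.1.refl _

/-! ### the ideal class is given by a rank -/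

def Zq (q : ℕ) (σ : Option (PM n) → Option (PM n) → Prop) : Prop := ∀ a, σ none a ↔ rnkLE a q

lemma Zq_dual {q} (hZ : Zq q σ) : Zq q (dual σ) := by
  intro a
  unfold dual
  rw [Option.map_none, hZ, rnkLE_fl]

lemma exists_q (hn : 1 ≤ n) (hσ : IsCongruence mul0 σ) (h : ¬ Z0 σ) : ∃ q ≤ n, Zq q σ := by
  classical
  have hex : ∃ q, q ≤ n ∧ ∃ α, σ none (some α) ∧ rnk α = q := by
    unfold Z0 at h
    push Not at h
    obtain ⟨a, h1, h2⟩ := h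
    rcases a with _ | α
    · exact absurd rfl h2
    · exact ⟨_, rnk_le α, α, h1, rfl⟩
  obtain ⟨q0, hq0n, hq0⟩ := hex
  let P : ℕ → Prop := fun q => ∃ α, σ none (some α) ∧ rnk α = q
  have hspec : P (Nat.findGreatest P n) := Nat.findGreatest_spec hq0n hq0
  refine ⟨Nat.findGreatest P n, Nat.findGreatest_le n, ?_⟩
  obtain ⟨α, hα, hr⟩ := hspec
  intro a
  rcases a with _ | β
  · exact ⟨fun _ => rnkLE_none _, fun _ => hσ.1.refl _⟩
  rw [rnkLE_some]
  constructor
  · intro h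
    exact Nat.le_findGreatest (rnk_le β) ⟨β, h, rfl⟩
  · intro h
    refine Jle (P := fun x => σ none x) hn ?_ (hr ▸ h) hα
    intro a x b hx
    have := (hσ.2 _ _ b (hσ.2 _ _ a hx).1).2
    simpa using this

lemma Zq_iff {q} (hσ : IsCongruence mul0 σ) (hZ : Zq q σ) {a b} (h : σ a b) :
    rnkLE a q ↔ rnkLE b q := by
  rw [← hZ, ← hZ]
  exact ⟨fun h' => hσ.1.trans h' h, fun h' => hσ.1.trans h' (hσ.1.symm h)⟩

lemma Zq_rnk {q} (hσ : IsCongruence mul0 σ) (hZ : Zq q σ) {α β} (h : σ (some α) (some β)) :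
    q < rnk α ↔ q < rnk β := by
  have := Zq_iff hσ hZ h
  rw [rnkLE_some, rnkLE_some] at this
  omega

/-! ### case q ≥ 1 : colourings -/

def Good {Q : ℕ} (α : PM n) (f : Fin n → Fin Q) : Prop :=
  (∀ i j, U α i j → f i = f j) ∧ ∀ s, ∃ i, f i = s ∧ Dm α i

lemma good_iff {q} {α : PM n} {f : Fin n → Fin (q + 1)} :
    ¬ rnkLE (mul0 (some (eps f 1)) (some α)) q ↔ Good α f := by
  have hp : Phi (eps f 1) α = 0 := Phi_zero.2 fun k =>
    ⟨k, E_refl _ _ _, Or.inl ⟨k, T_eps.2 (by simp)⟩⟩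
  rw [mul0_some hp, rnkLE_some, not_le]
  constructor
  · intro h
    obtain ⟨a, b, ha, hb⟩ := rnk_ge.1 (Nat.succ_le_of_lt h)
    have inj : Function.Injective (fun s => f (a s)) := fun s t hst =>
      ha s t (U_mul.2 (Or.inl (U_eps.2 hst)))
    have surj := Finite.surjective_of_injective inj
    have hinv : ∀ i j, U α i j → f i = f j := by
      intro i j hij
      obtain ⟨s, hs⟩ := surj (f i)
      obtain ⟨t, ht⟩ := surj (f j)
      have : s = t := ha s t (U_mul.2 (Or.inr ⟨i, j, T_eps.2 (by simpa using hs), E_U hij,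
        T_eps.2 (by simpa using ht)⟩))
      rw [← hs, ← ht, this]
    refine ⟨hinv, fun s => ?_⟩
    obtain ⟨t, ht⟩ := surj s
    obtain ⟨k, l, h1, h2, h3⟩ := T_mul.1 (hb t)
    have e1 : f (a t) = f k := by simpa using T_eps.1 h1
    have e2 : f k = f l := E_map f (fun _ _ h => L_eps.1 h) hinv h2
    exact ⟨l, by rw [← e2, ← e1, ← ht], _, h3⟩
  · rintro ⟨h1, h2⟩
    choose a ha hD using h2
    refine rnk_ge'.2 ⟨a, fun s t h => ?_, fun s => ?_⟩
    · have : f (a s) = f (a t) := by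
        rcases U_mul.1 h with h | ⟨k, l, h3, h4, h5⟩
        · exact U_eps.1 h
        · have e1 : f (a s) = f k := by simpa using T_eps.1 h3
          have e2 : f k = f l := E_map f (fun _ _ h => L_eps.1 h) h1 h4
          have e3 : f (a t) = f l := by simpa using T_eps.1 h5
          rw [e1, e2, e3]
      rwa [ha, ha] at this
    · exact Dm_mul.2 ⟨a s, a s, T_eps.2 (by simp), E_refl _ _ _, hD s⟩

lemma Good_iff {q} (hσ : IsCongruence mul0 σ) (hZ : Zq q σ) {α β} (h : σ (some α) (some β))
    (f : Fin n → Fin (q + 1)) : Good α f ↔ Good β f := by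
  rw [← good_iff, ← good_iff, Zq_iff hσ hZ (mulL hσ _ h)]

lemma other {Q : ℕ} (hQ : 2 ≤ Q) (s : Fin Q) : ∃ t : Fin Q, t ≠ s := by
  haveI : Nontrivial (Fin Q) := Fin.nontrivial_iff_two_le.2 hQ
  exact exists_ne s

lemma sep {Q : ℕ} (hQ : 2 ≤ Q) {α : PM n} (hα : Q ≤ rnk α) {i j} (hij : ¬ U α i j) :
    ∃ f : Fin n → Fin Q, Good α f ∧ f i ≠ f j := by
  classical
  obtain ⟨a, ha, hD⟩ := rnk_ge'.1 hα
  obtain ⟨c, hc, hca⟩ := exists_colors (by omega) ha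
  by_cases hne : c i = c j
  · have key : ∀ i j, ¬ U α i j → c i = c j → (∀ t, ¬ U α j (a t)) →
        ∃ f : Fin n → Fin Q, Good α f ∧ f i ≠ f j := by
      intro i j hij hne hj
      obtain ⟨t, ht⟩ := other hQ (c i)
      refine ⟨fun k => if U α j k then t else c k, ⟨?_, ?_⟩, ?_⟩
      · intro x y hxy
        have : U α j x ↔ U α j y := ⟨fun h => U_trans h hxy, fun h => U_trans h (U_symm hxy)⟩
        simp only [this, hc x y hxy]
      · intro s
        exact ⟨a s, by simp [hj s, hca], hD s⟩
      · have h1 : ¬ U α j i := fun h => hij (U_symm h)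
        simp only [h1, U_refl, if_true, if_false]
        exact ht.symm
    by_cases hj : ∀ t, ¬ U α j (a t)
    · exact key i j hij hne hj
    · by_cases hi : ∀ t, ¬ U α i (a t)
      · obtain ⟨f, h1, h2⟩ := key j i (fun h => hij (U_symm h)) hne.symm hi
        exact ⟨f, h1, h2.symm⟩
      · push Not at hi hj
        obtain ⟨s, hs⟩ := hi
        obtain ⟨t, ht⟩ := hj
        have : s = t := by rw [← hca s, ← hca t, ← hc _ _ hs, ← hc _ _ ht, hne]
        subst this
        exact absurd (U_trans hs (U_symm ht)) hij
  · exact ⟨c, ⟨hc, fun s => ⟨a s, hca s, hD s⟩⟩, hne⟩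

lemma fam_with {Q : ℕ} (hQ : 1 ≤ Q) {α : PM n} (hα : Q ≤ rnk α) {i} (hi : Dm α i) :
    ∃ (a : Fin Q → Fin n) (s0 : Fin Q), (∀ s t, U α (a s) (a t) → s = t) ∧ (∀ s, Dm α (a s)) ∧
      U α i (a s0) := by
  classical
  obtain ⟨a, ha, hD⟩ := rnk_ge'.1 hα
  by_cases h : ∃ s, U α i (a s)
  · obtain ⟨s, hs⟩ := h
    exact ⟨a, s, ha, hD, hs⟩
  · push Not at h
    refine ⟨Function.update a ⟨0, hQ⟩ i, ⟨0, hQ⟩, ?_, ?_, by simp [U_refl]⟩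
    · intro s t
      by_cases hs : s = ⟨0, hQ⟩ <;> by_cases ht : t = ⟨0, hQ⟩
      · intro _; rw [hs, ht]
      · subst hs; rw [Function.update_self, Function.update_of_ne ht]
        intro h'; exact absurd h' (h _)
      · subst ht; rw [Function.update_self, Function.update_of_ne hs]
        intro h'; exact absurd (U_symm h') (h _)
      · rw [Function.update_of_ne hs, Function.update_of_ne ht]; exact ha s t
    · intro s
      by_cases hs : s = ⟨0, hQ⟩
      · subst hs; rw [Function.update_self]; exact hi
      · rw [Function.update_of_ne hs]; exact hD s

lemma sepD {Q : ℕ} (hQ : 2 ≤ Q) {α : PM n} (hα : Q ≤ rnk α) {i} (hi : Dm α i) :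
    ∃ f : Fin n → Fin Q, Good α f ∧ ∀ k, f k = f i → U α i k := by
  classical
  obtain ⟨a, s0, ha, hD, h0⟩ := fam_with (by omega) hα hi
  obtain ⟨c, hc, hca⟩ := exists_colors (by omega) ha
  obtain ⟨t, ht⟩ := other hQ s0
  have hfi : (if U α i i then s0 else if c i = s0 then t else c i) = s0 := if_pos (U_refl _ _)
  refine ⟨fun k => if U α i k then s0 else if c k = s0 then t else c k, ⟨?_, ?_⟩, ?_⟩
  · intro x y hxy
    have : U α i x ↔ U α i y := ⟨fun h => U_trans h hxy, fun h => U_trans h (U_symm hxy)⟩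
    simp only [this, hc x y hxy]
  · intro s
    refine ⟨a s, ?_, hD s⟩
    by_cases hs : s = s0
    · subst hs; simp [h0]
    · have : ¬ U α i (a s) := fun h => hs (ha _ _ (U_trans (U_symm h) h0))
      simp [this, hca, hs]
  · intro k hk
    simp only at hk
    rw [hfi] at hk
    by_contra hc'
    rw [if_neg hc'] at hk
    split_ifs at hk with h
    · exact ht hk
    · exact h hk

lemma Zq_U {q} (hq : 1 ≤ q) (hσ : IsCongruence mul0 σ) (hZ : Zq q σ) {α β}
    (h : σ (some α) (some β)) (hα : q < rnk α) {i j} (hij : U β i j) : U α i j := by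
  by_contra hc
  obtain ⟨f, hf, hne⟩ := sep (Q := q + 1) (by omega) hα hc
  exact hne (((Good_iff hσ hZ h f).1 hf).1 _ _ hij)

lemma Zq_D {q} (hq : 1 ≤ q) (hσ : IsCongruence mul0 σ) (hZ : Zq q σ) {α β}
    (h : σ (some α) (some β)) (hα : q < rnk α) {i} (hi : Dm α i) : Dm β i := by
  obtain ⟨f, hf, hh⟩ := sepD (Q := q + 1) (by omega) hα hi
  obtain ⟨k, hk, hk'⟩ := ((Good_iff hσ hZ h f).1 hf).2 (f i)
  have h1 := hh k hk
  have h2 := Zq_U hq hσ hZ (hσ.1.symm h) ((Zq_rnk hσ hZ h).1 hα) h1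
  exact Dm_U (U_symm h2) hk'

lemma Zq_R {q} (hq : 1 ≤ q) (hσ : IsCongruence mul0 σ) (hZ : Zq q σ) {α β}
    (h : σ (some α) (some β)) (hα : q < rnk α) : greenR pmul α β := by
  have hβ := (Zq_rnk hσ hZ h).1 hα
  have h' := hσ.1.symm h
  exact greenR_iff.2 ⟨fun i j => ⟨Zq_U hq hσ hZ h' hβ, Zq_U hq hσ hZ h hα⟩,
    fun i => ⟨Zq_D hq hσ hZ h hα, Zq_D hq hσ hZ h' hβ⟩⟩

lemma Zq_H {q} (hq : 1 ≤ q) (hσ : IsCongruence mul0 σ) (hZ : Zq q σ) {α β}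
    (h : σ (some α) (some β)) (hα : q < rnk α) : greenH pmul α β :=
  ⟨Zq_R hq hσ hZ h hα, greenL_fl.2
    (Zq_R hq (dual_cong hσ) (Zq_dual hZ) (dual_some h) (by rwa [rnk_fl]))⟩

/-! ### case q = 0 -/

def Bad (α : PM n) (X : Fin n → Prop) : Prop := Iso α X ∨ IsoW α (fun i => ¬ X i)

lemma bad_iff {α : PM n} (hα : 0 < rnk α) {X : Fin n → Prop} :
    rnkLE (mul0 (some (gX X)) (some α)) 0 ↔ Bad α X := by
  by_cases hp : Phi (gX X) α = 0
  · rw [mul0_some hp, rnkLE_some, Nat.le_zero, gX_rank0 hα]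
    have : ¬ Iso α X := fun h => by
      have := gX_none.2 h
      rw [mul0_some hp] at this
      cases this
    simp [Bad, this]
  · have := mul0_float hp
    rw [this]
    exact ⟨fun _ => Or.inl (gX_none.1 this), fun _ => rnkLE_none _⟩

lemma Bad_iff (hσ : IsCongruence mul0 σ) (hZ : Zq 0 σ) {α β} (h : σ (some α) (some β))
    (hα : 0 < rnk α) (X : Fin n → Prop) : Bad α X ↔ Bad β X := by
  rw [← bad_iff hα, ← bad_iff ((Zq_rnk hσ hZ h).1 hα), Zq_iff hσ hZ (mulL hσ _ h)]

lemma nBad {α : PM n} {X : Fin n → Prop} {i j} (hi : Dm α i) (hj : Dm α j) (hX : X i) (hX' : ¬ X j) :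
    ¬ Bad α X := by
  rintro (h | h)
  · exact h.2.2 _ hX hi
  · exact h.2 _ hX' hj

lemma nBad_mul (hσ : IsCongruence mul0 σ) (hZ : Zq 0 σ) {α β} (h : σ (some α) (some β))
    (hα : 0 < rnk α) {X : Fin n → Prop} (hX : ¬ Bad α X) :
    σ (some (pmul (gX X) α)) (some (pmul (gX X) β)) ∧ 0 < rnk (pmul (gX X) α) := by
  have h1 : ¬ Bad β X := fun h' => hX ((Bad_iff hσ hZ h hα X).2 h')
  have hβ := (Zq_rnk hσ hZ h).1 hα
  have p1 : Phi (gX X) α = 0 := by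
    by_contra hp
    exact hX (Or.inl (gX_none.1 (mul0_float hp)))
  have p2 : Phi (gX X) β = 0 := by
    by_contra hp
    exact h1 (Or.inl (gX_none.1 (mul0_float hp)))
  have := mulL hσ (gX X) h
  rw [mul0_some p1, mul0_some p2] at this
  refine ⟨this, ?_⟩
  rw [← bad_iff hα, mul0_some p1, rnkLE_some] at hX
  omega

lemma Z1_U1 (hσ : IsCongruence mul0 σ) (hZ : Zq 0 σ) {α β} (h : σ (some α) (some β))
    (hα : 0 < rnk α) {i j} (hi : Dm α i) (hj : Dm α j) (hij : U β i j) (hn : ¬ U α i j) :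
    ∀ k l, T α i k → Cd β l → L α k l := by
  intro k l hk hl
  obtain ⟨m, hm⟩ := hj
  have hkm : ¬ L α k m := fun h' => hn (T_T_U (T_L hk h') hm)
  have n1 : ¬ Bad α (U α i) := nBad hi ⟨_, hm⟩ (U_refl _ _) hn
  obtain ⟨h1, hr1⟩ := nBad_mul hσ hZ h hα n1
  have hσ' := dual_cong hσ
  have hZ' := Zq_dual hZ
  have b1 := (Bad_iff hσ' hZ' (dual_some h1) (by rwa [rnk_fl]) _).1 (Or.inl (gA_iso hk))
  have n2 : ¬ Bad (fl α) (L α k) :=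
    nBad (Dm_fl.2 ⟨_, hk⟩) (Dm_fl.2 ⟨_, hm⟩) (L_refl _ _) hkm
  have n3 : ¬ Bad (fl β) (L α k) := fun h' =>
    n2 ((Bad_iff hσ' hZ' (dual_some h) (by rwa [rnk_fl]) _).2 h')
  have conn : ∀ x, E (gX (U α i)) β j x := by
    intro x
    by_cases hx : U α i x
    · exact E_trans (E_U (U_symm hij)) (E_L (L_gX.2 ⟨fun _ => hx, fun _ => U_refl _ _⟩))
    · exact E_L (L_gX.2 ⟨fun h => absurd h hn, fun h => absurd h hx⟩)
  have cd : ∀ l, Cd β l → Cd (pmul (gX (U α i)) β) l := by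
    rintro l ⟨x, hx⟩
    exact ⟨j, T_mul.2 ⟨j, x, T_gX.2 ⟨hn, hn⟩, conn x, hx⟩⟩
  rcases b1 with b | b
  · exfalso
    apply n3
    left
    refine ⟨b.1, fun x y hx hxy => b.2.1 x y hx ?_, fun x hx hx' => b.2.2 x hx ?_⟩
    · exact L_mul.2 (Or.inl hxy)
    · exact Dm_fl.2 (cd _ (Dm_fl.1 hx'))
  · by_contra hc
    exact b.2 l hc (Dm_fl.2 (cd l hl))

lemma Z1_U (hσ : IsCongruence mul0 σ) (hZ : Zq 0 σ) {α β} (h : σ (some α) (some β))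
    (hα : 0 < rnk α) {i j} (hij : U β i j) : U α i j := by
  by_contra hn
  have key : ∀ i j, U β i j → ¬ U α i j → Dm α i := by
    intro i j hij hn
    by_contra hi
    rcases (Bad_iff hσ hZ h hα _).1 (Or.inl (Iso_class hi)) with b | b
    · exact hn (b.2.1 i j (U_refl _ _) hij)
    · exact b.1 j i hn (U_symm hij) (U_refl _ _)
  have hi := key i j hij hn
  have hn' : ¬ U α j i := fun h => hn (U_symm h)
  have hj := key j i (U_symm hij) hn'
  obtain ⟨x, l, hl⟩ := rnk_pos.1 ((Zq_rnk hσ hZ h).1 hα)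
  have a1 := Z1_U1 hσ hZ h hα hi hj hij hn
  have a2 := Z1_U1 hσ hZ h hα hj hi (U_symm hij) hn'
  obtain ⟨k, hk⟩ := hi
  obtain ⟨m, hm⟩ := hj
  exact hn (T_T_U (T_L hk (a1 k l hk ⟨_, hl⟩)) (T_L hm (a2 m l hm ⟨_, hl⟩)))

lemma Z1_UU (hσ : IsCongruence mul0 σ) (hZ : Zq 0 σ) {α β} (h : σ (some α) (some β))
    (hα : 0 < rnk α) (i j) : U α i j ↔ U β i j :=
  ⟨fun hh => Z1_U hσ hZ (hσ.1.symm h) ((Zq_rnk hσ hZ h).1 hα) hh, fun hh => Z1_U hσ hZ h hα hh⟩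

lemma Z1_hat (hσ : IsCongruence mul0 σ) (hZ : Zq 0 σ) {α β} (h : σ (some α) (some β))
    (hα : 0 < rnk α) : hat α = hat β :=
  hat_iff.2 ⟨Z1_UU hσ hZ h hα,
    Z1_UU (dual_cong hσ) (Zq_dual hZ) (dual_some h) (by rwa [rnk_fl])⟩

lemma Z1_R (hσ : IsCongruence mul0 σ) (hZ : Zq 0 σ) {α β} (h : σ (some α) (some β))
    (hα : 2 ≤ rnk α) : greenR pmul α β := by
  have hα' : 0 < rnk α := by omega
  have hU := Z1_UU hσ hZ h hα'
  obtain ⟨x, y, hx, hy, hxy⟩ := rnk_two.1 hα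
  have oth : ∀ i, ∃ j, Dm α j ∧ ¬ U α i j := by
    intro i
    by_cases hi : U α i x
    · exact ⟨y, hy, fun h' => hxy (U_trans (U_symm hi) h')⟩
    · exact ⟨x, hx, hi⟩
  have d1 : ∀ i, Dm α i → Dm β i := by
    intro i hi
    by_contra hc
    obtain ⟨j, hj, hij⟩ := oth i
    refine nBad (X := U α i) hi hj (U_refl _ _) hij ((Bad_iff hσ hZ h hα' _).2 (Or.inl ?_))
    have : U α i = U β i := by funext j; exact propext (hU i j)
    rw [this]
    exact Iso_class hc
  refine greenR_iff.2 ⟨hU, fun i => ⟨d1 i, fun hi => ?_⟩⟩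
  by_contra hc
  obtain ⟨j, hj, hij⟩ := oth i
  exact nBad (X := U α i) hi (d1 j hj) (U_refl _ _) hij
    ((Bad_iff hσ hZ h hα' _).1 (Or.inl (Iso_class hc)))

lemma Z1_H (hσ : IsCongruence mul0 σ) (hZ : Zq 0 σ) {α β} (h : σ (some α) (some β))
    (hα : 2 ≤ rnk α) : greenH pmul α β :=
  ⟨Z1_R hσ hZ h hα, greenL_fl.2
    (Z1_R (dual_cong hσ) (Zq_dual hZ) (dual_some h) (by rwa [rnk_fl]))⟩

/-! ### high rank -/

lemma high {m : ℕ} (hσ : IsCongruence mul0 σ)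
    (hH : ∀ α β, σ (some α) (some β) → m ≤ rnk α → greenH pmul α β) {α β}
    (h : σ (some α) (some β)) (hα : m + 1 ≤ rnk α) : α = β := by
  classical
  have key : ∀ {α β}, σ (some α) (some β) → m + 1 ≤ rnk α → ∀ i j, T α i j → T β i j := by
    intro α β h hα i j hij
    obtain ⟨⟨hU, hD⟩, hL, hC⟩ := greenH_iff.1 (hH _ _ h (by omega))
    let u : Fin n → Bool ⊕ Quotient α := fun k =>
      if U α i k then Sum.inl true else Sum.inr (Quotient.mk α (Sum.inl k))
    let l : Fin n → Bool ⊕ Quotient α := fun k =>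
      if U α i k then Sum.inl false else Sum.inr (Quotient.mk α (Sum.inl k))
    have hl : ∀ x y, U α x y → l x = l y := by
      intro x y hxy
      have : U α i x ↔ U α i y := ⟨fun h => U_trans h hxy, fun h => U_trans h (U_symm hxy)⟩
      simp only [l, this]
      rw [show Quotient.mk α (Sum.inl x) = Quotient.mk α (Sum.inl y) from Quotient.sound hxy]
    have hl' : ∀ x y, U β x y → l x = l y := fun x y h => hl x y ((hU x y).2 h)
    have hul : ∀ x y, u x = l y ↔ ¬ U α i x ∧ U α x y := by
      intro x y
      by_cases hx : U α i x <;> by_cases hy : U α i y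
      · simp [u, l, hx, hy]
      · simp [u, l, hx, hy]
      · have : ¬ U α x y := fun h => hx (U_trans hy (U_symm h))
        simp [u, l, hx, hy, this]
      · simp only [u, l, hx, hy, if_false, not_false_eq_true, true_and]
        exact ⟨fun h => Quotient.exact (Sum.inr_injective h),
          fun h => congrArg Sum.inr (Quotient.sound h)⟩
    have fl' : ∀ k, (∃ x, u x = l k) ∨ ∃ k', l k' = l k ∧ Dm α k' := by
      intro k
      by_cases hk : U α i k
      · exact Or.inr ⟨i, hl _ _ hk, _, hij⟩
      · exact Or.inl ⟨k, (hul k k).2 ⟨hk, U_refl _ _⟩⟩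
    have p1 : Phi (mk u l) α = 0 := (LM_Phi hl).2 fl'
    have p2 : Phi (mk u l) β = 0 := (LM_Phi hl').2 (fun k => by simpa only [← hD] using fl' k)
    have hr := mulL hσ (mk u l) h
    rw [mul0_some p1, mul0_some p2] at hr
    have hrk : m ≤ rnk (pmul (mk u l) α) := by
      obtain ⟨a, ha, hDa⟩ := rnk_ge'.1 hα
      have : ∃ s, ∀ t, U α i (a t) → t = s := by
        by_cases hx : ∃ s, U α i (a s)
        · obtain ⟨s, hs⟩ := hx
          exact ⟨s, fun t ht => ha _ _ (U_trans (U_symm ht) hs)⟩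
        · push Not at hx
          exact ⟨0, fun t ht => absurd ht (hx t)⟩
      obtain ⟨s, hs⟩ := this
      have hna : ∀ t, ¬ U α i (a (s.succAbove t)) := fun t ht =>
        Fin.succAbove_ne s t (hs _ ht)
      refine rnk_ge'.2 ⟨fun t => a (s.succAbove t), ?_, ?_⟩
      · intro t t' htt
        rw [LM_U hl] at htt
        simp only [u, hna, if_false] at htt
        exact Fin.succAbove_right_injective (ha _ _ (Quotient.exact (Sum.inr_injective htt)))
      · intro t
        obtain ⟨y, hy⟩ := hDa (s.succAbove t)
        exact ⟨y, (LM_T hl).2 ⟨_, (hul _ _).2 ⟨hna t, U_refl _ _⟩, hy⟩⟩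
    obtain ⟨-, -, hC'⟩ := greenH_iff.1 (hH _ _ hr hrk)
    obtain ⟨k, hk⟩ := (hC j).1 ⟨_, hij⟩
    have : U α i k := by
      by_contra hc
      have : Cd (pmul (mk u l) β) j := ⟨k, (LM_T hl').2 ⟨k, (hul _ _).2 ⟨hc, U_refl _ _⟩, hk⟩⟩
      obtain ⟨x, hx⟩ := (hC' j).2 this
      obtain ⟨y, hy, hy'⟩ := (LM_T hl).1 hx
      obtain ⟨b1, b2⟩ := (hul _ _).1 hy
      exact b1 (U_trans (T_T_U hij hy') (U_symm b2))
    exact U_T ((hU _ _).1 this) hk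
  obtain ⟨⟨hU, hD⟩, hL, hC⟩ := greenH_iff.1 (hH _ _ h (by omega))
  have hr : rnk α = rnk β := rnk_congr hU hD
  exact PM_ext hU hL (fun i j => ⟨key h hα i j, key (hσ.1.symm h) (hr ▸ hα) i j⟩)

end main



section final
variable {σ : Option (PM n) → Option (PM n) → Prop}

lemma eq_SS {q : ℕ} (hσ : IsCongruence mul0 σ) (hZ : Zq q σ) {r : PM n → PM n → Prop}
    (h1 : ∀ α β, r α β → σ (some α) (some β))
    (h2 : ∀ α β, σ (some α) (some β) → q < rnk α → α ≠ β → r α β) : σ = SS q r := by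
  funext a b
  apply propext
  constructor
  · intro h
    by_cases ha : rnkLE a q
    · exact Or.inl (Or.inr ⟨ha, (Zq_iff hσ hZ h).1 ha⟩)
    · have hb : ¬ rnkLE b q := fun hb => ha ((Zq_iff hσ hZ h).2 hb)
      rcases a with _ | α
      · exact absurd (rnkLE_none q) ha
      rcases b with _ | β
      · exact absurd (rnkLE_none q) hb
      by_cases he : α = β
      · exact Or.inl (Or.inl (by rw [he]))
      · rw [rnkLE_some, not_le] at ha
        exact Or.inr ⟨α, β, rfl, rfl, h2 _ _ h ha he⟩
  · rintro ((rfl | ⟨ha, hb⟩) | ⟨α, β, rfl, rfl, h⟩)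
    · exact hσ.1.refl _
    · exact hσ.1.trans (hσ.1.symm ((hZ a).2 ha)) ((hZ b).2 hb)
    · exact h1 _ _ h

lemma Rees_SS (q : ℕ) : (ReesQ (n := n) q) = SS q (fun _ _ => False) := by
  funext a b
  apply propext
  constructor
  · exact Or.inl
  · rintro (h | ⟨_, _, _, _, h⟩)
    · exact h
    · exact h.elim

variable {Q : ℕ}

lemma upG {f : Fin n → Fin Q} (hf : Function.Surjective f) {α β : PM n} {a b : Fin Q → Fin n}
    {π : Equiv.Perm (Fin Q)} (hr : rnk β ≤ Q)
    (hU : ∀ i j, U α i j ↔ U β i j) (hL : ∀ i j, L α i j ↔ L β i j)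
    (ha : ∀ s t, U α (a s) (a t) → s = t) (hb : ∀ s t, L α (b s) (b t) → s = t)
    (hT : ∀ s, T β (a s) (b (π s))) :
    mul0 (mul0 (some (mk (labU α a) (fun i => Sum.inl (f i)))) (some (eps f π)))
      (some (mk (fun i => Sum.inl (f i)) (labU (fl α) b))) = some β := by
  have hb' : ∀ s t, U (fl α) (b s) (b t) → s = t := hb
  refine two' ?_ ?_ ?_ ?_ ?_ ?_ ?_ ?_
  · intro i j h; rw [U_eps.1 h]
  · intro i j h; rw [L_eps.1 h]
  · intro k j k' j' h h'
    rw [T_eps] at h h'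
    simp [← h, ← h']
  · intro k
    exact Or.inl ⟨a (f k), labU_pos ha (U_refl _ _)⟩
  · intro j
    exact Or.inl ⟨b (f j), labU_pos hb' (U_refl _ _)⟩
  · intro i i'; rw [labU_eq ha, hU]
  · intro i j'
    constructor
    · intro h
      obtain ⟨s, hs⟩ := rnk_complete hr (fun s t h => ha s t ((hU _ _).2 h))
        (fun s => ⟨_, hT s⟩) ⟨_, h⟩
      obtain ⟨k, hk⟩ := hf s
      obtain ⟨j, hj⟩ := hf (π s)
      refine ⟨k, j, ?_, ?_, ?_⟩
      · rw [labU_pos ha ((hU _ _).2 hs), hk]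
      · rw [T_eps, hk, hj]
      · rw [hj]
        symm
        apply labU_pos hb'
        exact (hL _ _).2 (T_T_L h (U_T hs (hT s)))
    · rintro ⟨k, j, h1, h2, h3⟩
      rw [labU_inl ha] at h1
      have h3 := h3.symm
      rw [labU_inl hb'] at h3
      rw [T_eps] at h2
      have := hT (f k)
      rw [h2] at this
      exact T_L (U_T ((hU _ _).1 h1) this) (L_symm ((hL _ _).1 h3))
  · intro i i'; rw [labU_eq hb', U_fl, hL]

/-- a representation of the permutational difference -/
def Rep (α β : PM n) (a b : Fin Q → Fin n) (π : Equiv.Perm (Fin Q)) : Prop :=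
  (∀ s t, U α (a s) (a t) → s = t) ∧ (∀ s, T α (a s) (b s)) ∧ ∀ s, T β (a s) (b (π s))

lemma exists_rep {α β : PM n} (r1 : rnk α = Q) (hH : greenH pmul α β) :
    ∃ a b π, Rep (Q := Q) α β a b π := by
  obtain ⟨⟨hU, hD⟩, hL, hC⟩ := greenH_iff.1 hH
  obtain ⟨a, b, ha, hb⟩ := rnk_ge.1 r1.ge
  have : ∀ s, ∃ t, T β (a s) (b t) := by
    intro s
    obtain ⟨j, hj⟩ := (hD _).1 ⟨_, hb s⟩
    obtain ⟨i, hi⟩ := (hC _).2 ⟨_, hj⟩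
    obtain ⟨t, ht⟩ := rnk_complete r1.le ha (fun s => ⟨_, hb s⟩) ⟨_, hi⟩
    exact ⟨t, T_L hj ((hL _ _).1 (T_T_L hi (U_T ht (hb t))))⟩
  choose π hπ using this
  have inj : Function.Injective π := by
    intro s t h
    have h1 := hπ s
    rw [h] at h1
    exact ha _ _ ((hU _ _).2 (T_T_U h1 (hπ t)))
  exact ⟨a, b, Equiv.ofBijective π (Finite.injective_iff_bijective.1 inj), ha, hb, hπ⟩

lemma sig_iff (hσ : IsCongruence mul0 σ) (h0 : 1 ≤ Q) {f : Fin n → Fin Q}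
    (hf : Function.Surjective f) {α β : PM n} (r1 : rnk α = Q) (r2 : rnk β = Q)
    (hH : greenH pmul α β) {a b π} (hR : Rep (Q := Q) α β a b π) :
    σ (some α) (some β) ↔ σ (some (eps f 1)) (some (eps f π)) := by
  obtain ⟨⟨hU, hD⟩, hL, hC⟩ := greenH_iff.1 hH
  obtain ⟨ha, hb, hb'⟩ := hR
  constructor
  · intro h
    obtain ⟨c, hc, hca⟩ := exists_colors h0 ha
    obtain ⟨d, hd, hdc⟩ := exists_colorsL h0 hc
    have e1 := down hf (π := 1) hc hd (fun k j h => by simpa using hdc k j h)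
      (fun s => ⟨a s, b s, hb s, hca s⟩)
    have e2 := down (α := β) hf (π := π) (c := c) (d := d) (fun i j h => hc i j ((hU _ _).2 h))
      (fun i j h => hd i j ((hL _ _).2 h)) (fun k j h => by
        obtain ⟨s, hs⟩ := rnk_complete r2.le (fun s t h => ha s t ((hU _ _).2 h))
          (fun s => ⟨_, hb' s⟩) ⟨_, h⟩
        rw [hc _ _ ((hU _ _).2 hs), hca, hd _ _ ((hL _ _).2 (T_T_L h (U_T hs (hb' s)))),
          hdc _ _ (hb (π s)), hca])
      (fun s => ⟨a s, _, hb' s, hca s⟩)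
    rw [← e1, ← e2]
    exact (hσ.2 _ _ _ (hσ.2 _ _ _ h).1).2
  · intro h
    have hbL : ∀ s t, L α (b s) (b t) → s = t := fam_L (π := 1) ha (by simpa using hb)
    have e1 := upG hf (π := 1) r1.le (fun _ _ => Iff.rfl) (fun _ _ => Iff.rfl) ha hbL
      (by simpa using hb)
    have e2 := upG hf (π := π) r2.le hU hL ha hbL hb'
    rw [← e1, ← e2]
    exact (hσ.2 _ _ _ (hσ.2 _ _ _ h).1).2

lemma rep_one (hQ : Q ≤ n) (h0 : 1 ≤ Q) {α β : PM n} (r1 : rnk α = Q) (r2 : rnk β = Q)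
    (hH : greenH pmul α β) {a b} (hR : Rep (Q := Q) α β a b 1) : α = β := by
  obtain ⟨f, hf⟩ := exists_surj hQ h0
  exact Option.some_inj.1 ((sig_iff cong_eq h0 hf r1 r2 hH hR).2 rfl)

lemma eps_mul {f : Fin n → Fin Q} (hf : Function.Surjective f) (π ρ : Equiv.Perm (Fin Q)) :
    mul0 (some (eps f π)) (some (eps f ρ)) = some (eps f (ρ * π)) := by
  have hl : ∀ i j, U (eps f ρ) i j → f i = f j := fun i j h => U_eps.1 h
  have hp : Phi (eps f π) (eps f ρ) = 0 := by
    unfold eps at hl ⊢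
    rw [LM_Phi hl]
    intro k
    obtain ⟨i, hi⟩ := hf (π.symm (f k))
    exact Or.inl ⟨i, by simp [hi]⟩
  rw [mul0_some hp]
  congr 1
  refine PM_ext ?_ ?_ ?_
  · intro i j
    rw [U_eps]
    conv_lhs => rw [eps]
    rw [LM_U hl]
    simp
  · intro i j
    rw [L_eps]
    conv_lhs => rw [eps]
    rw [LM_L hl, L_eps]
    simp only [T_eps]
    constructor
    · rintro (h | ⟨k, k', h1, h2, h3⟩)
      · exact h
      · rw [← h1, ← h3, h2]
    · exact Or.inl
  · intro i j
    rw [T_eps]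
    conv_lhs => rw [eps]
    rw [LM_T hl]
    simp only [T_eps, Equiv.Perm.mul_apply]
    constructor
    · rintro ⟨k, h1, h2⟩
      rw [h1, h2]
    · intro h
      obtain ⟨k, hk⟩ := hf (π (f i))
      exact ⟨k, hk.symm, by rw [hk, h]⟩

/-- the normal subgroup of a congruence -/
def NN (hσ : IsCongruence mul0 σ) {f : Fin n → Fin Q} (hf : Function.Surjective f) :
    Subgroup (Equiv.Perm (Fin Q)) where
  carrier := {π | σ (some (eps f 1)) (some (eps f π))}
  one_mem' := hσ.1.refl _
  mul_mem' := by
    intro ρ π h1 h2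
    have := mulL hσ (eps f π) h1
    rw [eps_mul hf, eps_mul hf, one_mul] at this
    exact hσ.1.trans h2 this
  inv_mem' := by
    intro π h
    have := mulL hσ (eps f π⁻¹) h
    rw [eps_mul hf, eps_mul hf, one_mul, mul_inv_cancel] at this
    exact hσ.1.symm this

lemma mem_NN {hσ : IsCongruence mul0 σ} {f : Fin n → Fin Q} {hf : Function.Surjective f} {π} :
    π ∈ NN hσ hf ↔ σ (some (eps f 1)) (some (eps f π)) := Iff.rfl

lemma NN_normal (hσ : IsCongruence mul0 σ) {f : Fin n → Fin Q} (hf : Function.Surjective f) :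
    (NN hσ hf).Normal := by
  refine ⟨fun π h g => ?_⟩
  have := mulR hσ (eps f g) (α := eps f g⁻¹) (β := eps f (π * g⁻¹)) (by
    have := mulL hσ (eps f g⁻¹) h
    rwa [eps_mul hf, eps_mul hf, one_mul] at this)
  rw [eps_mul hf, eps_mul hf, mul_inv_cancel, ← mul_assoc] at this
  exact this

lemma case_big {q : ℕ} (hσ : IsCongruence mul0 σ) (hZ : Zq q σ) (hq : 1 ≤ q) (hqn : q + 1 ≤ n) :
    σ = ReesQ q ∨ ∃ N : Subgroup (Equiv.Perm (Fin (q + 1))), N.Normal ∧ N ≠ ⊥ ∧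
      σ = SS q (nuRel (q + 1) N) := by
  obtain ⟨f, hf⟩ := exists_surj (Q := q + 1) hqn (by omega)
  have hr : ∀ α β, σ (some α) (some β) → q < rnk α → α ≠ β → rnk α = q + 1 := by
    intro α β h h1 hne
    by_contra hc
    exact hne (high (m := q + 1) hσ (fun α β h hh => Zq_H hq hσ hZ h hh) h (by omega))
  have hnu : ∀ α β, σ (some α) (some β) → q < rnk α → α ≠ β → nuRel (q + 1) (NN hσ hf) α β := by
    intro α β h h1 hne
    have r1 := hr α β h h1 hne
    have r2 := hr β α (hσ.1.symm h) ((Zq_rnk hσ hZ h).1 h1) hne.symm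
    have hH := Zq_H hq hσ hZ h h1
    obtain ⟨a, b, π, hR⟩ := exists_rep r1 hH
    have := (sig_iff hσ (by omega) hf r1 r2 hH hR).1 h
    exact ⟨r1, r2, hH, a, b, π, hR.1, hR.2.1, hR.2.2, this⟩
  by_cases hN : NN hσ hf = ⊥
  · left
    rw [Rees_SS]
    refine eq_SS hσ hZ (fun _ _ h => h.elim) ?_
    intro α β h h1 hne
    obtain ⟨r1, r2, hH, a, b, π, ha, hb, hb', hπ⟩ := hnu α β h h1 hne
    rw [hN, Subgroup.mem_bot] at hπ
    subst hπ
    exact hne (rep_one hqn (by omega) r1 r2 hH ⟨ha, hb, hb'⟩)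
  · right
    refine ⟨NN hσ hf, NN_normal hσ hf, hN, eq_SS hσ hZ ?_ hnu⟩
    rintro α β ⟨r1, r2, hH, a, b, π, ha, hb, hb', hπ⟩
    exact (sig_iff hσ (by omega) hf r1 r2 hH ⟨ha, hb, hb'⟩).2 hπ

/-! ### the case of the ideal of rank 0 -/

def AllDn (σ : Option (PM n) → Option (PM n) → Prop) : Prop :=
  ∀ β β', muR β β' → (∀ j, Cd β j ↔ Cd β' j) → σ (some β) (some β')
def AllUp (σ : Option (PM n) → Option (PM n) → Prop) : Prop :=
  ∀ β β', muR β β' → (∀ j, Dm β j ↔ Dm β' j) → σ (some β) (some β')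

lemma AllUp_dual (h : AllDn (dual σ)) : AllUp σ := by
  intro β β' hm hD
  have := dual_some' (h (fl β) (fl β') (muR_fl.2 hm) (fun j => by rw [Cd_fl, Cd_fl, hD]))
  rwa [fl_fl, fl_fl] at this

lemma srcDn (hσ : IsCongruence mul0 σ) {α α' : PM n} (h : σ (some α) (some α')) (hm : muR α α')
    (hne : ¬ ∀ i, Dm α i ↔ Dm α' i) : AllDn σ := by
  obtain ⟨r, r', hh⟩ := hm
  have hU := (hat_iff.1 hh).1
  intro β β' hm' hC
  refine claimG hσ hU r r' ?_ h hm'.1 hm'.2.1 hm'.2.2 hC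
  intro i hi hi'
  refine hne fun k => ⟨fun hk => ?_, fun hk => ?_⟩
  · exact Dm_U ((hU _ _).1 (rnk_one r.le hi hk)) hi'
  · exact Dm_U ((hU _ _).2 (rnk_one r'.le hi' hk)) hi

lemma srcUp (hσ : IsCongruence mul0 σ) {α α' : PM n} (h : σ (some α) (some α')) (hm : muR α α')
    (hne : ¬ ∀ i, Cd α i ↔ Cd α' i) : AllUp σ := by
  refine AllUp_dual (srcDn (dual_cong hσ) (dual_some h) (muR_fl.2 hm) ?_)
  simpa only [Dm_fl] using hne

lemma exists_mid {β β' : PM n} (hm : muR β β') :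
    ∃ γ : PM n, muR β γ ∧ (∀ i, Dm β i ↔ Dm γ i) ∧ ∀ j, Cd γ j ↔ Cd β' j := by
  classical
  obtain ⟨s, s', hh⟩ := hm
  obtain ⟨hU, hL⟩ := hat_iff.1 hh
  let u : Fin n → Option (Quotient β ⊕ Quotient β) := fun i =>
    if Dm β i then none else some (Sum.inl (Quotient.mk β (Sum.inl i)))
  let l : Fin n → Option (Quotient β ⊕ Quotient β) := fun i =>
    if Cd β' i then none else some (Sum.inr (Quotient.mk β (Sum.inr i)))
  obtain ⟨i0, j0, hT0⟩ := rnk_pos.1 s.ge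
  obtain ⟨i1, j1, hT1⟩ := rnk_pos.1 s'.ge
  have gU : ∀ i j, U β i j ↔ U (mk u l) i j := by
    intro i j
    rw [U_mk]
    by_cases hi : Dm β i <;> by_cases hj : Dm β j
    · simp only [u, hi, hj, if_true, iff_true]
      exact rnk_one s.le hi hj
    · simp only [u, hi, hj, if_true, if_false, reduceCtorEq, iff_false]
      exact fun h => hj (Dm_U h hi)
    · simp only [u, hi, hj, if_true, if_false, reduceCtorEq, iff_false]
      exact fun h => hi (Dm_U (U_symm h) hj)
    · simp only [u, hi, hj, if_false, Option.some_inj, Sum.inl.injEq]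
      exact Quotient.eq.symm
  have gL : ∀ i j, L β i j ↔ L (mk u l) i j := by
    intro i j
    rw [L_mk]
    by_cases hi : Cd β' i <;> by_cases hj : Cd β' j
    · simp only [l, hi, hj, if_true, iff_true, hL]
      exact T_T_L ((T_rank1 s'.le).2 ⟨⟨_, hT1⟩, hi⟩) ((T_rank1 s'.le).2 ⟨⟨_, hT1⟩, hj⟩)
    · simp only [l, hi, hj, if_true, if_false, reduceCtorEq, iff_false, hL]
      exact fun h => hj (Cd_L h hi)
    · simp only [l, hi, hj, if_true, if_false, reduceCtorEq, iff_false, hL]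
      exact fun h => hi (Cd_L (L_symm h) hj)
    · simp only [l, hi, hj, if_false, Option.some_inj, Sum.inr.injEq]
      exact Quotient.eq.symm
  have gT : ∀ i j, T (mk u l) i j ↔ Dm β i ∧ Cd β' j := by
    intro i j
    rw [T_mk]
    by_cases hi : Dm β i <;> by_cases hj : Cd β' j <;> simp [u, l, hi, hj]
  have gD : ∀ i, Dm β i ↔ Dm (mk u l) i := fun i =>
    ⟨fun h => ⟨j1, (gT _ _).2 ⟨h, _, hT1⟩⟩, fun ⟨j, hj⟩ => ((gT _ _).1 hj).1⟩
  have gC : ∀ j, Cd (mk u l) j ↔ Cd β' j := fun i =>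
    ⟨fun ⟨j, hj⟩ => ((gT _ _).1 hj).2, fun h => ⟨i0, (gT _ _).2 ⟨⟨_, hT0⟩, h⟩⟩⟩
  exact ⟨mk u l, ⟨s, by rw [← s]; exact (rnk_congr gU gD).symm, hat_iff.2 ⟨gU, gL⟩⟩, gD, gC⟩

lemma all_mu (hσ : IsCongruence mul0 σ) (h1 : AllDn σ) (h2 : AllUp σ) {β β' : PM n}
    (hm : muR β β') : σ (some β) (some β') := by
  obtain ⟨γ, hγ, hD, hC⟩ := exists_mid hm
  exact hσ.1.trans (h2 _ _ hγ hD) (h1 _ _ (muR_trans (muR_symm hγ) hm) hC)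

lemma perm2 (π : Equiv.Perm (Fin 2)) (h : π 0 = 0) : π = 1 := by
  revert π; decide
lemma perm2' (π ρ : Equiv.Perm (Fin 2)) (h : π ≠ 1) (h' : ρ ≠ 1) : π = ρ := by
  revert π ρ; decide

lemma swapDn (hσ : IsCongruence mul0 σ) {f : Fin n → Fin 2} (hf : Function.Surjective f)
    {π : Equiv.Perm (Fin 2)} (hπ : π ≠ 1) (h : σ (some (eps f 1)) (some (eps f π))) : AllDn σ := by
  let v : Fin n → Bool := fun j => decide (f j = 0)
  let w : Fin n → Bool := fun _ => true
  have hv : ∀ ρ : Equiv.Perm (Fin 2), ∀ i j, L (eps f ρ) i j → v i = v j := by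
    intro ρ i j h
    simp only [v, L_eps.1 h]
  have hp : ∀ ρ : Equiv.Perm (Fin 2), Phi (eps f ρ) (mk v w) = 0 := by
    intro ρ
    rw [RM_Phi (hv ρ)]
    intro k
    obtain ⟨i, hi⟩ := hf (ρ.symm (f k))
    exact Or.inr ⟨k, rfl, i, T_eps.2 (by simp [hi])⟩
  have hT : ∀ ρ : Equiv.Perm (Fin 2), ∀ i j, T (pmul (eps f ρ) (mk v w)) i j ↔ ρ (f i) = 0 := by
    intro ρ i j
    rw [RM_T (hv ρ)]
    simp only [T_eps, v, w, decide_eq_true_eq]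
    constructor
    · rintro ⟨k, h1, h2⟩; rw [h1, h2]
    · intro h
      obtain ⟨k, hk⟩ := hf 0
      exact ⟨k, by rw [h, hk], hk⟩
  have hU : ∀ ρ : Equiv.Perm (Fin 2), ∀ i j, U (pmul (eps f ρ) (mk v w)) i j ↔ f i = f j := by
    intro ρ i j
    rw [RM_U (hv ρ), U_eps]
    constructor
    · rintro (h | ⟨k, k', h1, h2, h3⟩)
      · exact h
      · rw [T_eps] at h1 h3
        have : f k = f k' := by
          simp only [v, decide_eq_decide] at h2
          omega
        exact ρ.injective (by rw [h1, h3, this])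
    · exact Or.inl
  have hL : ∀ ρ : Equiv.Perm (Fin 2), ∀ i j, L (pmul (eps f ρ) (mk v w)) i j := by
    intro ρ i j
    rw [RM_L (hv ρ)]
  have hD : ∀ ρ : Equiv.Perm (Fin 2), ∀ i, Dm (pmul (eps f ρ) (mk v w)) i ↔ ρ (f i) = 0 :=
    fun ρ i => ⟨fun ⟨j, hj⟩ => (hT ρ i j).1 hj, fun h => ⟨i, (hT ρ i i).2 h⟩⟩
  have hr : ∀ ρ : Equiv.Perm (Fin 2), rnk (pmul (eps f ρ) (mk v w)) = 1 := by
    intro ρ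
    apply le_antisymm
    · by_contra hc
      obtain ⟨i, j, hi, hj, hn⟩ := rnk_two.1 (by omega : 2 ≤ rnk (pmul (eps f ρ) (mk v w)))
      rw [hD] at hi hj
      exact hn ((hU ρ _ _).2 (ρ.injective (hi.trans hj.symm)))
    · obtain ⟨i, hi⟩ := hf (ρ.symm 0)
      exact rnk_pos.2 ⟨i, i, (hT ρ i i).2 (by simp [hi])⟩
  have key := mulR hσ (mk v w) h
  rw [mul0_some (hp 1), mul0_some (hp π)] at key
  refine srcDn hσ key ⟨hr 1, hr π, hat_iff.2 ⟨fun i j => by rw [hU, hU], fun i j => by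
    simp only [hL]⟩⟩ ?_
  intro hc
  obtain ⟨i, hi⟩ := hf 0
  have := (hc i).1 ((hD 1 i).2 (by simp [hi]))
  rw [hD, hi] at this
  exact hπ (perm2 _ this)

lemma fl_eps {f : Fin n → Fin Q} {π : Equiv.Perm (Fin Q)} : fl (eps f π) = eps f π⁻¹ := by
  refine PM_ext (fun i j => ?_) (fun i j => ?_) (fun i j => ?_)
  · rw [U_fl, L_eps, U_eps]
  · rw [L_fl, L_eps, U_eps]
  · rw [T_fl, T_eps, T_eps, Equiv.Perm.inv_eq_iff_eq, eq_comm]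

lemma swapUp (hσ : IsCongruence mul0 σ) {f : Fin n → Fin 2} (hf : Function.Surjective f)
    {π : Equiv.Perm (Fin 2)} (hπ : π ≠ 1) (h : σ (some (eps f 1)) (some (eps f π))) : AllUp σ := by
  apply AllUp_dual
  have := dual_some h
  rw [fl_eps, fl_eps, inv_one] at this
  exact swapDn (dual_cong hσ) hf (by simpa using hπ) this

lemma case_zero (hn : 2 ≤ n) (hσ : IsCongruence mul0 σ) (hZ : Zq 0 σ) :
    σ = ReesQ 0 ∨ σ = SS 0 (fun α β : PM n => muR α β ∧ greenR pmul α β) ∨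
      σ = SS 0 (fun α β : PM n => muR α β ∧ greenL pmul α β) ∨ σ = SS 0 muR ∨
      σ = SS (n := n) 0 (fun α β => muR α β ∨ nuRel 2 ⊤ α β) := by
  have hr : ∀ α β, σ (some α) (some β) → α ≠ β → rnk α ≤ 2 := by
    intro α β h hne
    by_contra hc
    exact hne (high (m := 2) hσ (fun α β h hh => Z1_H hσ hZ h hh) h (by omega))
  by_cases h2 : ∃ α β, σ (some α) (some β) ∧ α ≠ β ∧ 2 ≤ rnk α
  · right; right; right; right
    obtain ⟨f, hf⟩ := exists_surj (Q := 2) hn (by omega)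
    have h2' : ∀ α β, σ (some α) (some β) → α ≠ β → 2 ≤ rnk α →
        rnk α = 2 ∧ rnk β = 2 ∧ greenH pmul α β := by
      intro α β h hne hα
      have hH := Z1_H hσ hZ h hα
      have e := greenR_iff.1 hH.1
      have := rnk_congr e.1 e.2
      have := hr α β h hne
      exact ⟨by omega, by omega, hH⟩
    obtain ⟨α, β, h, hne, hα⟩ := h2
    obtain ⟨r1, r2, hH⟩ := h2' _ _ h hne hα
    obtain ⟨a, b, π, hR⟩ := exists_rep r1 hH
    have hπ : π ≠ 1 := by
      rintro rfl
      exact hne (rep_one hn (by omega) r1 r2 hH hR)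
    have hs := (sig_iff hσ (by omega) hf r1 r2 hH hR).1 h
    have d1 := swapDn hσ hf hπ hs
    have d2 := swapUp hσ hf hπ hs
    refine eq_SS hσ hZ ?_ ?_
    · rintro α β (hm | ⟨r1, r2, hH, a, b, ρ, ha, hb, hb', hρ⟩)
      · exact all_mu hσ d1 d2 hm
      · rw [sig_iff hσ (by omega) hf r1 r2 hH ⟨ha, hb, hb'⟩]
        by_cases hρ : ρ = 1
        · rw [hρ]; exact hσ.1.refl _
        · rw [perm2' ρ π hρ hπ]; exact hs
    · intro α β h hp hne
      by_cases hα : 2 ≤ rnk α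
      · obtain ⟨r1, r2, hH⟩ := h2' _ _ h hne hα
        obtain ⟨a, b, ρ, hR⟩ := exists_rep r1 hH
        exact Or.inr ⟨r1, r2, hH, a, b, ρ, hR.1, hR.2.1, hR.2.2, Subgroup.mem_top _⟩
      · have hβ : ¬ 2 ≤ rnk β := fun hβ => by
          have := (h2' _ _ (hσ.1.symm h) hne.symm hβ).2.1; omega
        have := (Zq_rnk hσ hZ h).1 hp
        exact Or.inl ⟨by omega, by omega, Z1_hat hσ hZ h hp⟩
  · push Not at h2
    have hm : ∀ α β, σ (some α) (some β) → 0 < rnk α → α ≠ β → muR α β := by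
      intro α β h hp hne
      have h1 := h2 _ _ h hne
      have h3 := h2 _ _ (hσ.1.symm h) hne.symm
      have := (Zq_rnk hσ hZ h).1 hp
      exact ⟨by omega, by omega, Z1_hat hσ hZ h hp⟩
    by_cases hD : ∃ α β, σ (some α) (some β) ∧ muR α β ∧ ¬ ∀ i, Dm α i ↔ Dm β i
    · obtain ⟨α, β, h, hmu, hne⟩ := hD
      have d1 := srcDn hσ h hmu hne
      by_cases hC : ∃ α β, σ (some α) (some β) ∧ muR α β ∧ ¬ ∀ i, Cd α i ↔ Cd β i
      · obtain ⟨α, β, h, hmu, hne⟩ := hC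
        have d2 := srcUp hσ h hmu hne
        right; right; right; left
        exact eq_SS hσ hZ (fun _ _ h => all_mu hσ d1 d2 h) hm
      · push Not at hC
        right; right; left
        refine eq_SS hσ hZ (fun _ _ h => d1 _ _ h.1 (greenL_iff.1 h.2).2) ?_
        intro α β h hp hne
        have hmu := hm α β h hp hne
        exact ⟨hmu, greenL_iff.2 ⟨(hat_iff.1 hmu.2.2).2, hC _ _ h hmu⟩⟩
    · push Not at hD
      by_cases hC : ∃ α β, σ (some α) (some β) ∧ muR α β ∧ ¬ ∀ i, Cd α i ↔ Cd β i
      · obtain ⟨α, β, h, hmu, hne⟩ := hC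
        have d2 := srcUp hσ h hmu hne
        right; left
        refine eq_SS hσ hZ (fun _ _ h => d2 _ _ h.1 (greenR_iff.1 h.2).2) ?_
        intro α β h hp hne
        have hmu := hm α β h hp hne
        exact ⟨hmu, greenR_iff.2 ⟨(hat_iff.1 hmu.2.2).1, hD _ _ h hmu⟩⟩
      · push Not at hC
        left
        rw [Rees_SS]
        refine eq_SS hσ hZ (fun _ _ h => h.elim) ?_
        intro α β h hp hne
        have hmu := hm α β h hp hne
        obtain ⟨hU, hL⟩ := hat_iff.1 hmu.2.2
        exact hne (PM_ext hU hL fun i j => by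
          rw [T_rank1 hmu.1.le, T_rank1 hmu.2.1.le, hD _ _ h hmu, hC _ _ h hmu])

end final

lemma SS_assoc (p : PM n → PM n → Prop) :
    (fun a b => ReesQ 0 a b ∨ lift2 (fun α β => rnk α = 1 ∧ rnk β = 1 ∧ hat α = hat β ∧ p α β) a b)
      = SS 0 (fun α β : PM n => muR α β ∧ p α β) := by
  have : (fun α β : PM n => muR α β ∧ p α β) =
      fun α β => rnk α = 1 ∧ rnk β = 1 ∧ hat α = hat β ∧ p α β := by
    funext α β
    simp only [muR, and_assoc]
  rw [this]
  rfl

lemma SS_or : (fun a b : Option (PM n) => (ReesQ 0 a b ∨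
        lift2 (fun α β => rnk α = 1 ∧ rnk β = 1 ∧ hat α = hat β) a b) ∨
        nuOpt 2 ⊤ a b) = SS (n := n) 0 (fun α β => muR α β ∨ nuRel 2 ⊤ α β) := by
  funext a b
  apply propext
  constructor
  · rintro ((h | ⟨α, β, h1, h2, h⟩) | ⟨α, β, h1, h2, h⟩)
    · exact Or.inl h
    · exact Or.inr ⟨α, β, h1, h2, Or.inl h⟩
    · exact Or.inr ⟨α, β, h1, h2, Or.inr h⟩
  · rintro (h | ⟨α, β, h1, h2, h | h⟩)
    · exact Or.inl (Or.inl h)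
    · exact Or.inl (Or.inr ⟨α, β, h1, h2, h⟩)
    · exact Or.inr ⟨α, β, h1, h2, h⟩

/-- For `n ≥ 2`, the congruences on the 0-twisted partition monoid
`P_{n,0}^Φ` are precisely: the Rees congruences `R_q` for `q ∈ {−∞,0,…,n}` (with
`R_{−∞}` equality and `R_n` universal), the relations `R_N = R_{q−1} ∪ ν_N` for
`2 ≤ q ≤ n` and nontrivial `N ⊴ S_q`, and the four relations `μ↑`, `μ↓`, `μ`,
`μ_{S_2} = μ ∪ ν_{S_2}`. -/
theorem zero_twisted_classification (n : ℕ) (hn : 2 ≤ n)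
    (σ : Option (PM n) → Option (PM n) → Prop) :
    IsCongruence (mul0 (n := n)) σ ↔
      (σ = (· = ·)) ∨
      (∃ q, q ≤ n ∧ σ = ReesQ q) ∨
      (∃ q, 2 ≤ q ∧ q ≤ n ∧ ∃ N : Subgroup (Equiv.Perm (Fin q)), N.Normal ∧ N ≠ ⊥ ∧
        σ = fun a b => ReesQ (q - 1) a b ∨ nuOpt q N a b) ∨
      (σ = fun a b => ReesQ 0 a b ∨
        lift2 (fun α β => rnk α = 1 ∧ rnk β = 1 ∧ hat α = hat β ∧
          greenR (pmul (n := n)) α β) a b) ∨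
      (σ = fun a b => ReesQ 0 a b ∨
        lift2 (fun α β => rnk α = 1 ∧ rnk β = 1 ∧ hat α = hat β ∧
          greenL (pmul (n := n)) α β) a b) ∨
      (σ = fun a b => ReesQ 0 a b ∨
        lift2 (fun α β => rnk α = 1 ∧ rnk β = 1 ∧ hat α = hat β) a b) ∨
      (σ = fun a b => (ReesQ 0 a b ∨
        lift2 (fun α β => rnk α = 1 ∧ rnk β = 1 ∧ hat α = hat β) a b) ∨
        nuOpt 2 ⊤ a b) := by
  rw [SS_assoc, SS_assoc, SS_or]
  constructor
  · intro hσ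
    by_cases h0 : Z0 σ
    · exact Or.inl (Z0_eq hσ h0)
    right
    obtain ⟨q, hq, hZ⟩ := exists_q (by omega) hσ h0
    rcases Nat.eq_zero_or_pos q with rfl | hpos
    · rcases case_zero hn hσ hZ with h | h | h | h | h
      · exact Or.inl ⟨0, hq, h⟩
      · exact Or.inr (Or.inr (Or.inl h))
      · exact Or.inr (Or.inr (Or.inr (Or.inl h)))
      · exact Or.inr (Or.inr (Or.inr (Or.inr (Or.inl h))))
      · exact Or.inr (Or.inr (Or.inr (Or.inr (Or.inr h))))
    · rcases Nat.lt_or_ge q n with hlt | hge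
      · rcases case_big hσ hZ hpos hlt with h | ⟨N, h1, h2, h3⟩
        · exact Or.inl ⟨q, hq, h⟩
        · exact Or.inr (Or.inl ⟨q + 1, by omega, hlt, N, h1, h2, h3⟩)
      · left
        refine ⟨q, hq, ?_⟩
        rw [Rees_SS]
        refine eq_SS hσ hZ (fun _ _ h => h.elim) ?_
        intro α β h hp
        have := rnk_le α
        omega
  · rintro (rfl | ⟨q, hq, rfl⟩ | ⟨q, hq, hqn, N, hN, -, rfl⟩ | rfl | rfl | rfl | rfl)
    · exact cong_eq
    · exact cong_Rees q
    · exact cong_nu (by omega) N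
    · exact cong_muUp
    · exact cong_muDn
    · exact cong_mu
    · exact cong_muS2

end TPM
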